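/- Fix α ∈ (0,1). For every ε > 0 there exist constants K > 0 and β₀ > 0 such that for all β ∈ (0, β₀): |E_∞(α,β) − C·β| ≤ K β^{2−ε}. -/

import Mathlib

open Filter

noncomputable section

open scoped Classical

namespace SyncDeletion

/-- The deletion output `y(x, d)`: the subsequence of `x` consisting of the bits `x i`
with `d i = false`, in order. -/
def yList (x d : List Bool) : List Bool :=
  ((x.zip d).filter (fun p => p.2 = false)).map Prod.fst

/-- Binary entropy function (base-2), with `binEnt 0 = binEnt 1 = 0`. -/
def binEnt (p : ℝ) : ℝ := -(p * Real.logb 2 p) - (1 - p) * Real.logb 2 (1 - p)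

/-- The constant `C = ∑_{l≥1} 2^{-l-1} l log₂ l` (the `l = 0` term vanishes). -/
def Cconst : ℝ := ∑' l : ℕ, (2 : ℝ) ^ (-(l : ℝ) - 1) * (l : ℝ) * Real.logb 2 (l : ℝ)

/-- Probability of an event `E` under a pmf `p` on a finite outcome space. -/
def prob {Ω : Type} [Fintype Ω] (p : Ω → ℝ) (E : Ω → Prop) : ℝ :=
  ∑ ω ∈ Finset.univ.filter E, p ω

/-- Conditional Shannon entropy (in bits) `H(f | g)` of the random variable `f`
given `g`, under the pmf `p`. -/
def condEnt {Ω A B : Type} [Fintype Ω] (p : Ω → ℝ) (f : Ω → A) (g : Ω → B) : ℝ :=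
  -∑ ab ∈ Finset.univ.image (fun ω => (f ω, g ω)),
    (if prob p (fun ω => f ω = ab.1 ∧ g ω = ab.2) = 0 then 0
     else prob p (fun ω => f ω = ab.1 ∧ g ω = ab.2) *
       Real.logb 2 (prob p (fun ω => f ω = ab.1 ∧ g ω = ab.2) /
         prob p (fun ω => g ω = ab.2)))

/-- Shannon entropy (in bits) `H(f)` of the random variable `f` under the pmf `p`. -/
def ent {Ω A : Type} [Fintype Ω] (p : Ω → ℝ) (f : Ω → A) : ℝ :=
  condEnt p f (fun _ => ())

/-- Stationary initial distribution of the deletion-pattern Markov chain: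
`P(D₀ = 1) = β/(α+β)`. -/
def initD (α β : ℝ) (b : Bool) : ℝ := if b then β / (α + β) else α / (α + β)

/-- Transition probabilities of the deletion-pattern Markov chain:
`P(1|1) = 1-α`, `P(0|1) = α`, `P(1|0) = β`, `P(0|0) = 1-β`. -/
def transD (α β : ℝ) (b b' : Bool) : ℝ :=
  if b then (if b' then 1 - α else α) else (if b' then β else 1 - β)

/-- Probability of a trajectory of the stationary two-state Markov chain. -/
def pMarkov (α β : ℝ) {m : ℕ} (dp : Fin (m + 1) → Bool) : ℝ :=
  initD α β (dp 0) * ∏ i : Fin m, transD α β (dp i.castSucc) (dp i.succ)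

/-- Joint pmf of the iid Bernoulli(1/2) source `X^n = ω.1` and the independent
deletion pattern `(D_0, …, D_{n+1}) = ω.2`. -/
def pJoint (α β : ℝ) (n : ℕ) (ω : (Fin n → Bool) × (Fin (n + 2) → Bool)) : ℝ :=
  (1 / 2 : ℝ) ^ n * pMarkov α β (m := n + 1) ω.2

/-- The deletion output `y(X^n, D^n)`: bits `X_i` with `D_i = 0` in order
(source bit `X_i` is governed by pattern bit `D_i`, i.e. index `i` of `ω.2`,
for `i = 1, …, n`). -/
def yOut {n : ℕ} (ω : (Fin n → Bool) × (Fin (n + 2) → Bool)) : List Bool :=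
  yList (List.ofFn ω.1)
    (List.ofFn (fun i : Fin n => ω.2 ⟨i.val + 1, by have := i.isLt; omega⟩))

/-- `a_n = H(X^n | y(X^n, D^n), D_0, D_{n+1})`. -/
def aSeq (α β : ℝ) (n : ℕ) : ℝ :=
  condEnt (pJoint α β n) (fun ω => ω.1)
    (fun ω => (yOut ω, ω.2 0, ω.2 (Fin.last (n + 1))))

/-- `E_n = H(D_1 | D_0, X^n, y(X^n, D^n), D_{n+1})`. -/
def Eseq (α β : ℝ) (n : ℕ) : ℝ :=
  condEnt (pJoint α β n) (fun ω => ω.2 1)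
    (fun ω => (ω.2 0, ω.1, yOut ω, ω.2 (Fin.last (n + 1))))

/-- `H(y(X^n, D^n) | X^n, D_0, D_{n+1})`. -/
def hygSeq (α β : ℝ) (n : ℕ) : ℝ :=
  condEnt (pJoint α β n) (fun ω => yOut ω)
    (fun ω => (ω.1, ω.2 0, ω.2 (Fin.last (n + 1))))

/-- `J_n = d + (1/n) H(y(X^n, D^n) | X^n, D_0, D_{n+1})` with `d = β/(α+β)`. -/
def Jseq (α β : ℝ) (n : ℕ) : ℝ := β / (α + β) + hygSeq α β n / n

/-- `I_n/n`: the normalized mutual information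
`(1/n)(H(y(X^n,D^n)) - H(y(X^n,D^n)|X^n))`. -/
def Iseq (α β : ℝ) (n : ℕ) : ℝ :=
  (ent (pJoint α β n) (fun ω => yOut ω) -
    condEnt (pJoint α β n) (fun ω => yOut ω) (fun ω => ω.1)) / n

/-- Error probability of a code `(enc, dec)` with message set `Fin M`. -/
def errProb (α β : ℝ) (n M : ℕ) (enc : (Fin n → Bool) → Fin M)
    (dec : Fin M × List Bool → (Fin n → Bool)) : ℝ :=
  prob (pJoint α β n) (fun ω => dec (enc ω.1, yOut ω) ≠ ω.1)

/-- `R` is an achievable rate: there is a sequence of codes whose error probability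
tends to `0` and whose rate `(1/n) log₂ |M_n|` has limsup at most `R`. -/
def IsAchievable (α β R : ℝ) : Prop :=
  ∃ M : ℕ → ℕ, ∃ enc : (n : ℕ) → (Fin n → Bool) → Fin (M n),
    ∃ dec : (n : ℕ) → Fin (M n) × List Bool → (Fin n → Bool),
      Tendsto (fun n => errProb α β n (M n) (enc n) (dec n)) atTop (nhds 0) ∧
      Filter.limsup (fun n : ℕ => Real.logb 2 (M n : ℝ) / (n : ℝ)) atTop ≤ R

/-- The minimum achievable rate `R_min(α, β)`. -/
def Rmin (α β : ℝ) : ℝ := sInf {R : ℝ | IsAchievable α β R}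

/-- `k = max {6, -6 / log₂(1-α)}`. -/
def kconst (α : ℝ) : ℝ := max 6 (-6 / Real.logb 2 (1 - α))

/-- `m = ⌊-k log₂ β⌋`. -/
def mlen (α β : ℝ) : ℕ := ⌊kconst α * (-Real.logb 2 β)⌋₊

/-- Number of ones among the entries of `dp` with index `≤ m`. -/
def onesCount {N : ℕ} (dp : Fin N → Bool) (m : ℕ) : ℕ :=
  (Finset.univ.filter (fun i : Fin N => i.val ≤ m ∧ dp i = true)).card

/-- Number of maximal runs of 1's among the entries of `dp` with index `≤ m`
(counted by their starting positions). -/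
def runsCount {N : ℕ} (dp : Fin N → Bool) (m : ℕ) : ℕ :=
  (Finset.univ.filter (fun i : Fin N => i.val ≤ m ∧ dp i = true ∧
    (i.val = 0 ∨ dp ⟨i.val - 1, lt_of_le_of_lt (Nat.sub_le _ _) i.isLt⟩ = false))).card

/-- The deletion pattern `(D_0, …, D_{n+1})` is typical: `(D_0, …, D_m)` contains at
most one maximal run of 1's and at most `⌊(k/3)(-log₂ β)⌋` ones, for `m = ⌊-k log₂ β⌋`. -/
def Typical (α β : ℝ) {n : ℕ} (dp : Fin (n + 2) → Bool) : Prop :=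
  runsCount dp (mlen α β) ≤ 1 ∧
    onesCount dp (mlen α β) ≤ ⌊(kconst α / 3) * (-Real.logb 2 β)⌋₊

/-- The joint pmf conditioned on the event `{T = 1}` that the deletion pattern is typical. -/
def pTypCond (α β : ℝ) (n : ℕ) (ω : (Fin n → Bool) × (Fin (n + 2) → Bool)) : ℝ :=
  if Typical α β ω.2 then
    pJoint α β n ω / prob (pJoint α β n) (fun ω' => Typical α β ω'.2)
  else 0

/-- `H(D_1 | X^n, y(X^n,D^n), D_0, D_{n+1}, T = 1) ⬝ P(T = 1)`. -/
def EseqTyp (α β : ℝ) (n : ℕ) : ℝ :=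
  condEnt (pTypCond α β n) (fun ω => ω.2 1)
    (fun ω => (ω.2 0, ω.1, yOut ω, ω.2 (Fin.last (n + 1)))) *
  prob (pJoint α β n) (fun ω => Typical α β ω.2)

/-- `(1/k) H(X_2^{k-1} | y(X_2^{k-1}, D_2^{k-1}), D_1, D_k)` (unnormalized). -/
def innerEnt (α β : ℝ) (k : ℕ) : ℝ :=
  condEnt (pJoint α β k)
    (fun ω => (fun i : Fin (k - 2) => ω.1 ⟨i.val + 1, by have := i.isLt; omega⟩))
    (fun ω =>
      (yList (List.ofFn (fun i : Fin (k - 2) => ω.1 ⟨i.val + 1, by have := i.isLt; omega⟩))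
        (List.ofFn (fun i : Fin (k - 2) => ω.2 ⟨i.val + 2, by have := i.isLt; omega⟩)),
       ω.2 1, ω.2 ⟨k, by omega⟩))

/-! ### Conditional entropy of a binary variable -/

/-- Unnormalised binary entropy of the weights `a`, `b`. -/
def pairEnt (a b : ℝ) : ℝ :=
  -(a * Real.logb 2 (a / (a + b))) - b * Real.logb 2 (b / (a + b))

lemma mul_log_sub_le {a S q : ℝ} (ha : 0 ≤ a) (hS : a ≤ S) (hq : 0 ≤ q) (hpos : 0 < a → 0 < q) :
    a * Real.log q - a * Real.log (a / S) ≤ q * S - a := by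
  rcases ha.eq_or_lt with rfl | h
  · simpa using mul_nonneg hq hS
  have hS' : 0 < S := h.trans_le hS
  have hq' := hpos h
  have h1 := Real.log_le_sub_one_of_pos (show 0 < q * S / a by positivity)
  rw [Real.log_div (by positivity) h.ne', Real.log_mul hq'.ne' hS'.ne'] at h1
  rw [Real.log_div h.ne' hS'.ne']
  have h2 := mul_le_mul_of_nonneg_left h1 ha
  have h3 : a * (q * S / a - 1) = q * S - a := by field_simp
  linarith

/-- The Gibbs inequality for a binary variable. -/
lemma pairEnt_le {a b q₀ q₁ : ℝ} (ha : 0 ≤ a) (hb : 0 ≤ b) (h₀ : 0 ≤ q₀) (h₁ : 0 ≤ q₁)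
    (hq : q₀ + q₁ ≤ 1) (hp₀ : 0 < a → 0 < q₀) (hp₁ : 0 < b → 0 < q₁) :
    pairEnt a b ≤ a * (-Real.logb 2 q₀) + b * (-Real.logb 2 q₁) := by
  have e₀ := mul_log_sub_le (S := a + b) ha (by linarith) h₀ hp₀
  have e₁ := mul_log_sub_le (S := a + b) hb (by linarith) h₁ hp₁
  have h2 : 0 < Real.log 2 := Real.log_pos one_lt_two
  have e : (a * Real.log q₀ - a * Real.log (a / (a + b))) +
      (b * Real.log q₁ - b * Real.log (b / (a + b))) ≤ 0 := by nlinarith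
  unfold pairEnt Real.logb
  have := div_nonpos_of_nonpos_of_nonneg e h2.le
  have e3 : a * (-(Real.log q₀ / Real.log 2)) + b * (-(Real.log q₁ / Real.log 2)) -
    (-(a * (Real.log (a / (a + b)) / Real.log 2)) -
      b * (Real.log (b / (a + b)) / Real.log 2)) =
    -(((a * Real.log q₀ - a * Real.log (a / (a + b))) +
      (b * Real.log q₁ - b * Real.log (b / (a + b)))) / Real.log 2) := by ring
  linarith

lemma logb_div_add_nonpos {a b : ℝ} (ha : 0 ≤ a) (hb : 0 ≤ b) :
    Real.logb 2 (a / (a + b)) ≤ 0 :=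
  Real.logb_nonpos one_lt_two (by positivity) (div_le_one_of_le₀ (by linarith) (by positivity))

lemma pairEnt_nonneg {a b : ℝ} (ha : 0 ≤ a) (hb : 0 ≤ b) : 0 ≤ pairEnt a b := by
  have h1 := logb_div_add_nonpos ha hb
  have h2 := logb_div_add_nonpos hb ha
  rw [add_comm b a] at h2
  unfold pairEnt
  nlinarith [mul_nonneg ha (neg_nonneg.2 h1), mul_nonneg hb (neg_nonneg.2 h2)]

lemma pairEnt_mono {a b a' b' : ℝ} (ha : 0 ≤ a) (hb : 0 ≤ b) (haa : a ≤ a') (hbb : b ≤ b') :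
    pairEnt a b ≤ pairEnt a' b' := by
  have ha' := ha.trans haa
  have hb' := hb.trans hbb
  have h1 := logb_div_add_nonpos ha' hb'
  have h2 := logb_div_add_nonpos hb' ha'
  rw [add_comm b' a'] at h2
  refine (pairEnt_le ha hb (q₀ := a' / (a' + b')) (q₁ := b' / (a' + b')) (by positivity)
    (by positivity) ?_ ?_ ?_).trans ?_
  · rw [← add_div]; exact div_self_le_one _
  · intro h; have : 0 < a' := h.trans_le haa; positivity
  · intro h; have : 0 < b' := h.trans_le hbb; positivity
  · unfold pairEnt
    nlinarith [mul_le_mul_of_nonneg_right haa (neg_nonneg.2 h1),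
      mul_le_mul_of_nonneg_right hbb (neg_nonneg.2 h2)]

lemma pairEnt_mul {c : ℝ} (hc : 0 < c) (a b : ℝ) :
    pairEnt (c * a) (c * b) = c * pairEnt a b := by
  unfold pairEnt
  rw [← mul_add, mul_div_mul_left _ _ hc.ne', mul_div_mul_left _ _ hc.ne']
  ring

section Ent

variable {Ω B : Type} [Fintype Ω]

lemma prob_eq_sum {p : Ω → ℝ} (E : Ω → Prop) : prob p E = ∑ ω, if E ω then p ω else 0 := by
  rw [prob, Finset.sum_filter]

lemma prob_nonneg {p : Ω → ℝ} (hp : ∀ ω, 0 ≤ p ω) (E : Ω → Prop) : 0 ≤ prob p E :=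
  Finset.sum_nonneg fun ω _ => hp ω

lemma prob_pos {p : Ω → ℝ} (hp : ∀ ω, 0 < p ω) {E : Ω → Prop} {ω : Ω} (h : E ω) :
    0 < prob p E :=
  Finset.sum_pos (fun ω _ => hp ω) ⟨ω, by simpa using h⟩

lemma prob_split (p : Ω → ℝ) (f : Ω → Bool) (E : Ω → Prop) :
    prob p E = prob p (fun ω => f ω = false ∧ E ω) + prob p (fun ω => f ω = true ∧ E ω) := by
  simp only [prob_eq_sum, ← Finset.sum_add_distrib]
  refine Finset.sum_congr rfl fun ω _ => ?_
  cases f ω <;> simp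

lemma condEnt_bool [DecidableEq B] (p : Ω → ℝ) (f : Ω → Bool) (g : Ω → B) :
    condEnt p f g = ∑ z ∈ Finset.univ.image g,
      pairEnt (prob p fun ω => f ω = false ∧ g ω = z) (prob p fun ω => f ω = true ∧ g ω = z) := by
  unfold condEnt
  rw [Finset.sum_subset (s₂ := (Finset.univ : Finset Bool) ×ˢ Finset.univ.image g),
    Finset.sum_product_right, ← Finset.sum_neg_distrib]
  · refine Finset.sum_congr rfl fun z _ => ?_
    rw [Fintype.sum_bool, prob_split p f (fun ω => g ω = z)]
    simp only [pairEnt]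
    split_ifs with h1 h2 h2 <;> (simp [h1, h2]; try ring)
  · intro ab
    simp only [Finset.mem_image, Finset.mem_univ, true_and, Finset.mem_product]
    rintro ⟨ω, rfl⟩
    exact ⟨ω, rfl⟩
  · intro ab _ h
    rw [if_pos]
    rw [prob_eq_sum]
    refine Finset.sum_eq_zero fun ω _ => if_neg ?_
    rintro ⟨h1, h2⟩
    refine h ?_
    simp only [Finset.mem_image, Finset.mem_univ, true_and]
    exact ⟨ω, Prod.ext h1 h2⟩

/-- Regrouping an expectation of a function of `(f, g)` along the fibres of `g`. -/
lemma sum_fiber [DecidableEq B] (p : Ω → ℝ) (f : Ω → Bool) (g : Ω → B) (c : Bool → B → ℝ) :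
    ∑ z ∈ Finset.univ.image g, ((prob p fun ω => f ω = false ∧ g ω = z) * c false z +
      (prob p fun ω => f ω = true ∧ g ω = z) * c true z) = ∑ ω, p ω * c (f ω) (g ω) := by
  simp only [prob_eq_sum, Finset.sum_mul, ← Finset.sum_add_distrib]
  rw [Finset.sum_comm]
  refine Finset.sum_congr rfl fun ω _ => ?_
  rw [Finset.sum_eq_single (g ω)]
  · cases f ω <;> simp
  · intro z _ hz
    simp [hz.symm]
  · intro h
    exact absurd (Finset.mem_image_of_mem g (Finset.mem_univ ω)) h

lemma condEnt_le_cost {p : Ω → ℝ} (hp : ∀ ω, 0 ≤ p ω) (f : Ω → Bool) (g : Ω → B)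
    (q : Bool → B → ℝ) (hq : ∀ b z, 0 < q b z) (hsum : ∀ z, q false z + q true z ≤ 1) :
    condEnt p f g ≤ ∑ ω, p ω * (-Real.logb 2 (q (f ω) (g ω))) := by
  rw [condEnt_bool, ← sum_fiber p f g (fun b z => -Real.logb 2 (q b z))]
  refine Finset.sum_le_sum fun z _ => ?_
  exact pairEnt_le (prob_nonneg hp _) (prob_nonneg hp _) (hq _ _).le (hq _ _).le (hsum z)
    (fun _ => hq _ _) (fun _ => hq _ _)

lemma condEnt_le_sum {p : Ω → ℝ} (hp : ∀ ω, 0 ≤ p ω) (f : Ω → Bool) (g : Ω → B) :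
    condEnt p f g ≤ ∑ ω, p ω := by
  refine (condEnt_le_cost hp f g (fun _ _ => 2⁻¹) (fun _ _ => by norm_num)
    (fun _ => by norm_num)).trans ?_
  simp [Real.logb_inv, Real.logb_self_eq_one]

end Ent

/-! ### The Markov chain and the output sequence -/

lemma sum_snoc {n : ℕ} (F : (Fin (n + 1) → Bool) → ℝ) :
    ∑ x, F x = ∑ x : Fin n → Bool, ∑ b : Bool, F (Fin.snoc x b) := by
  rw [← Equiv.sum_comp (Fin.snocEquiv (fun _ => Bool)) F, Fintype.sum_prod_type_right]
  rfl

lemma pMarkov_snoc (α β : ℝ) {m : ℕ} (d : Fin (m + 1) → Bool) (e : Bool) :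
    pMarkov α β (m := m + 1) (Fin.snoc d e) =
      pMarkov α β d * transD α β (d (Fin.last m)) e := by
  unfold pMarkov
  rw [Fin.prod_univ_castSucc, ← mul_assoc]
  have h0 : (Fin.snoc d e : Fin (m + 2) → Bool) 0 = d 0 := by
    rw [← Fin.castSucc_zero, Fin.snoc_castSucc]
  rw [h0]
  congr 1
  · congr 1
    refine Finset.prod_congr rfl fun i _ => ?_
    rw [Fin.snoc_castSucc, Fin.succ_castSucc, Fin.snoc_castSucc]
  · rw [Fin.snoc_castSucc, Fin.succ_last, Fin.snoc_last]

lemma sum_transD (α β : ℝ) (s : Bool) : ∑ b : Bool, transD α β s b = 1 := by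
  cases s <;> simp [transD]

section Params

variable {α β : ℝ}

lemma transD_pos (hα : 0 < α) (hα' : α < 1) (hβ : 0 < β) (hβ' : β < 1) (s b : Bool) :
    0 < transD α β s b := by
  cases s <;> cases b <;> simp [transD] <;> linarith

lemma initD_pos (hα : 0 < α) (hβ : 0 < β) (s : Bool) : 0 < initD α β s := by
  cases s <;> simp [initD] <;> positivity

lemma pMarkov_pos (hα : 0 < α) (hα' : α < 1) (hβ : 0 < β) (hβ' : β < 1) {m : ℕ}
    (d : Fin (m + 1) → Bool) : 0 < pMarkov α β d :=
  mul_pos (initD_pos hα hβ _) (Finset.prod_pos fun _ _ => transD_pos hα hα' hβ hβ' _ _)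

lemma pJoint_pos (hα : 0 < α) (hα' : α < 1) (hβ : 0 < β) (hβ' : β < 1) {n : ℕ}
    (ω : (Fin n → Bool) × (Fin (n + 2) → Bool)) : 0 < pJoint α β n ω :=
  mul_pos (by positivity) (pMarkov_pos hα hα' hβ hβ' _)

lemma sum_pMarkov (hα : 0 < α) (hβ : 0 < β) (m : ℕ) :
    ∑ d : Fin (m + 1) → Bool, pMarkov α β d = 1 := by
  induction m with
  | zero =>
    rw [sum_snoc]
    have : α + β ≠ 0 := by positivity
    simp [pMarkov, initD, Fin.snoc]
    field_simp
    ring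
  | succ m ih =>
    rw [sum_snoc, ← ih]
    refine Finset.sum_congr rfl fun d _ => ?_
    simp_rw [pMarkov_snoc]
    rw [← Finset.mul_sum, sum_transD, mul_one]

lemma sum_pJoint (hα : 0 < α) (hβ : 0 < β) (n : ℕ) : ∑ ω, pJoint α β n ω = 1 := by
  simp only [pJoint, Fintype.sum_prod_type, ← Finset.mul_sum, sum_pMarkov hα hβ]
  simp

lemma yList_append {x₁ d₁ x₂ d₂ : List Bool} (h : x₁.length = d₁.length) :
    yList (x₁ ++ x₂) (d₁ ++ d₂) = yList x₁ d₁ ++ yList x₂ d₂ := by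
  simp [yList, List.zip_append h]

lemma yOut_snoc {n : ℕ} (x : Fin n → Bool) (d : Fin (n + 2) → Bool) (b e : Bool) :
    yOut (n := n + 1) (Fin.snoc x b, Fin.snoc d e) =
      yOut (x, d) ++ if d (Fin.last (n + 1)) = false then [b] else [] := by
  unfold yOut
  dsimp only
  rw [List.ofFn_succ_last, List.ofFn_succ_last, yList_append (by simp)]
  congr 1
  · congr 1
    · simp [Fin.snoc_castSucc]
    · congr 1
      funext i
      exact Fin.snoc_castSucc (α := fun _ => Bool) (n := n + 2) e d ⟨i.val + 1, by omega⟩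
  · have h1 : (Fin.snoc d e : Fin (n + 3) → Bool) ⟨(Fin.last n).val + 1, by simp⟩ =
        d (Fin.last (n + 1)) :=
      Fin.snoc_castSucc (α := fun _ => Bool) (n := n + 2) e d (Fin.last (n + 1))
    rw [h1, Fin.snoc_last]
    cases d (Fin.last (n + 1)) <;> simp [yList]

lemma pJoint_snoc {n : ℕ} (x : Fin n → Bool) (d : Fin (n + 2) → Bool) (b e : Bool) :
    pJoint α β (n + 1) (Fin.snoc x b, Fin.snoc d e) =
      pJoint α β n (x, d) * (2⁻¹ * transD α β (d (Fin.last (n + 1))) e) := by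
  unfold pJoint
  dsimp only
  rw [pMarkov_snoc, pow_succ]
  ring

lemma Eseq_le_one (hα : 0 < α) (hα' : α < 1) (hβ : 0 < β) (hβ' : β < 1) (n : ℕ) :
    Eseq α β n ≤ 1 :=
  (condEnt_le_sum (fun ω => (pJoint_pos hα hα' hβ hβ' ω).le) _ _).trans_eq (sum_pJoint hα hβ n)

lemma Eseq_le_succ (hα : 0 < α) (hα' : α < 1) (hβ : 0 < β) (hβ' : β < 1) (n : ℕ) :
    Eseq α β n ≤ Eseq α β (n + 1) := by
  unfold Eseq
  set f : (Fin n → Bool) × (Fin (n + 2) → Bool) → Bool := fun ω => ω.2 1 with hf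
  set g : (Fin n → Bool) × (Fin (n + 2) → Bool) → Bool × (Fin n → Bool) × List Bool × Bool :=
    fun ω => (ω.2 0, ω.1, yOut ω, ω.2 (Fin.last (n + 1))) with hg
  set f' : (Fin (n + 1) → Bool) × (Fin (n + 3) → Bool) → Bool := fun ω => ω.2 1 with hf'
  set g' : (Fin (n + 1) → Bool) × (Fin (n + 3) → Bool) →
      Bool × (Fin (n + 1) → Bool) × List Bool × Bool :=
    fun ω => (ω.2 0, ω.1, yOut ω, ω.2 (Fin.last (n + 2))) with hg'
  let φ : Bool → Bool → Bool × (Fin n → Bool) × List Bool × Bool →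
      Bool × (Fin (n + 1) → Bool) × List Bool × Bool := fun b e z =>
    (z.1, Fin.snoc z.2.1 b, z.2.2.1 ++ (if z.2.2.2 = false then [b] else []), e)
  have hfs : ∀ x d b e, f' (Fin.snoc x b, Fin.snoc d e) = f (x, d) := by
    intro x d b e
    exact Fin.snoc_castSucc (α := fun _ => Bool) (n := n + 2) e d 1
  have hgs : ∀ x d b e, g' (Fin.snoc x b, Fin.snoc d e) = φ b e (g (x, d)) := by
    intro x d b e
    simp only [hg', hg, φ, yOut_snoc, Fin.snoc_last]
    rfl
  set p := pJoint α β n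
  set p' := pJoint α β (n + 1)
  have hp : ∀ ω, 0 < p ω := pJoint_pos hα hα' hβ hβ'
  have hp' : ∀ ω, 0 < p' ω := pJoint_pos hα hα' hβ hβ'
  let P' : Bool → _ → ℝ := fun a z => prob p' fun ω => f' ω = a ∧ g' ω = z
  let c : Bool → _ → ℝ := fun a z => -Real.logb 2 (P' a z / (P' false z + P' true z))
  have hP' : ∀ a z, 0 ≤ P' a z := fun a z => prob_nonneg (fun ω => (hp' ω).le) _
  have e1 : condEnt p' f' g' = ∑ ω, p' ω * c (f' ω) (g' ω) := by
    rw [condEnt_bool, ← sum_fiber p' f' g' c]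
    refine Finset.sum_congr rfl fun z _ => ?_
    simp only [pairEnt, c, P']
    ring
  have e2 : ∑ ω, p' ω * c (f' ω) (g' ω) = ∑ b : Bool, ∑ e : Bool, ∑ ω, p ω *
      ((2⁻¹ * transD α β (g ω).2.2.2 e) * c (f ω) (φ b e (g ω))) := by
    simp only [Fintype.sum_prod_type]
    rw [sum_snoc]
    simp_rw [sum_snoc (n := n + 2)]
    rw [Finset.sum_comm]
    refine Finset.sum_congr rfl fun b _ => ?_
    rw [Finset.sum_comm (s := (Finset.univ : Finset Bool))]
    refine Finset.sum_congr rfl fun x _ => ?_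
    rw [Finset.sum_comm (s := (Finset.univ : Finset Bool))]
    refine Finset.sum_congr rfl fun d _ => Finset.sum_congr rfl fun e _ => ?_
    rw [hfs, hgs, ← mul_assoc]
    congr 1
    exact pJoint_snoc x d b e
  rw [e1, e2]
  have e3 : ∀ b e : Bool, ∑ z ∈ Finset.univ.image g, (2⁻¹ * transD α β z.2.2.2 e) *
      pairEnt (prob p fun ω => f ω = false ∧ g ω = z) (prob p fun ω => f ω = true ∧ g ω = z) ≤
      ∑ ω, p ω * ((2⁻¹ * transD α β (g ω).2.2.2 e) * c (f ω) (φ b e (g ω))) := by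
    intro b e
    rw [← sum_fiber p f g (fun a z => (2⁻¹ * transD α β z.2.2.2 e) * c a (φ b e z))]
    refine Finset.sum_le_sum fun z _ => ?_
    have ht := transD_pos hα hα' hβ hβ' z.2.2.2 e
    have hpos : ∀ a, 0 < (prob p fun ω => f ω = a ∧ g ω = z) → 0 < P' a (φ b e z) := by
      intro a ha
      obtain ⟨ω, hω, -⟩ := Finset.exists_ne_zero_of_sum_ne_zero ha.ne'
      simp only [Finset.mem_filter, Finset.mem_univ, true_and] at hω
      refine prob_pos hp' (ω := (Fin.snoc ω.1 b, Fin.snoc ω.2 e)) ⟨?_, ?_⟩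
      · rw [hfs]; exact hω.1
      · rw [hgs]; exact congrArg _ hω.2
    have hA : ∀ a, 0 < P' a (φ b e z) →
        0 < P' a (φ b e z) / (P' false (φ b e z) + P' true (φ b e z)) := by
      intro a ha
      refine div_pos ha ?_
      cases a
      · linarith [hP' true (φ b e z)]
      · linarith [hP' false (φ b e z)]
    have key := pairEnt_le (prob_nonneg (fun ω => (hp ω).le) fun ω => f ω = false ∧ g ω = z)
      (prob_nonneg (fun ω => (hp ω).le) fun ω => f ω = true ∧ g ω = z)
      (q₀ := P' false (φ b e z) / (P' false (φ b e z) + P' true (φ b e z)))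
      (q₁ := P' true (φ b e z) / (P' false (φ b e z) + P' true (φ b e z)))
      (div_nonneg (hP' _ _) (add_nonneg (hP' _ _) (hP' _ _)))
      (div_nonneg (hP' _ _) (add_nonneg (hP' _ _) (hP' _ _)))
      (by rw [← add_div]; exact div_self_le_one _)
      (fun h => hA _ (hpos _ h)) (fun h => hA _ (hpos _ h))
    refine (mul_le_mul_of_nonneg_left key (by positivity)).trans_eq ?_
    simp only [c]
    ring
  refine le_trans (le_of_eq ?_)
    (Finset.sum_le_sum fun b _ => Finset.sum_le_sum fun e _ => e3 b e)
  rw [condEnt_bool]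
  simp_rw [Finset.sum_comm (t := Finset.univ.image g)]
  refine Finset.sum_congr rfl fun z _ => ?_
  simp_rw [← Finset.sum_mul, ← Finset.mul_sum, sum_transD]
  simp

lemma exists_tendsto_Eseq (hα : 0 < α) (hα' : α < 1) (hβ : 0 < β) (hβ' : β < 1) :
    ∃ E, Tendsto (fun n => Eseq α β n) atTop (nhds E) ∧ ∀ n, Eseq α β n ≤ E := by
  have hmono : Monotone fun n => Eseq α β n :=
    monotone_nat_of_le_succ (Eseq_le_succ hα hα' hβ hβ')
  have hb : BddAbove (Set.range fun n => Eseq α β n) := by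
    refine ⟨1, ?_⟩
    rintro _ ⟨n, rfl⟩
    exact Eseq_le_one hα hα' hβ hβ' n
  exact ⟨_, tendsto_atTop_ciSup hmono hb, fun n => le_ciSup hb n⟩

end Params

/-! ### Sequences extended to `ℕ`, and the two probability laws -/

/-- Extension of a finite bit string to all of `ℕ` by `false`. -/
def ext {n : ℕ} (x : Fin n → Bool) (k : ℕ) : Bool := if h : k < n then x ⟨k, h⟩ else false

lemma ext_snoc_lt {n : ℕ} (x : Fin n → Bool) (b : Bool) {k : ℕ} (hk : k < n) :
    ext (Fin.snoc x b : Fin (n + 1) → Bool) k = ext x k := by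
  unfold ext
  rw [dif_pos (by omega : k < n + 1), dif_pos hk]
  exact Fin.snoc_castSucc (α := fun _ => Bool) (n := n) b x ⟨k, hk⟩

lemma ext_snoc_self {n : ℕ} (x : Fin n → Bool) (b : Bool) :
    ext (Fin.snoc x b : Fin (n + 1) → Bool) n = b := by
  unfold ext
  rw [dif_pos (by omega : n < n + 1)]
  exact Fin.snoc_last (α := fun _ => Bool) (n := n) b x

lemma ext_last {n : ℕ} (x : Fin (n + 1) → Bool) : ext x n = x (Fin.last n) := by
  unfold ext
  rw [dif_pos (by omega : n < n + 1)]
  rfl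

lemma ofFn_getD {n : ℕ} (x : Fin n → Bool) (k : ℕ) : (List.ofFn x).getD k false = ext x k := by
  unfold ext
  rw [List.getD_eq_getElem?_getD, List.getElem?_ofFn]
  split_ifs <;> rfl

/-- The event `E` only depends on the coordinates `0, …, k`. -/
def DepOn (k : ℕ) (E : (ℕ → Bool) → Prop) : Prop :=
  ∀ D F : ℕ → Bool, (∀ i ≤ k, D i = F i) → (E D ↔ E F)

/-- Probability of an event of the deletion chain `(D_0, …, D_N)`. -/
def mProb (α β : ℝ) (N : ℕ) (E : (ℕ → Bool) → Prop) : ℝ :=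
  ∑ d : Fin (N + 1) → Bool, pMarkov α β d * if E (ext d) then 1 else 0

/-- Every one of the bits `D_k, …, D_{k+j}` is `1`. -/
def Ones (D : ℕ → Bool) (k j : ℕ) : Prop := ∀ i, k ≤ i → i ≤ k + j → D i = true

section Markov

variable {α β : ℝ}

lemma mProb_succ {N : ℕ} {E : (ℕ → Bool) → Prop} (hE : DepOn N E) :
    mProb α β (N + 1) E = mProb α β N E := by
  unfold mProb
  rw [sum_snoc]
  refine Finset.sum_congr rfl fun d _ => ?_
  have : ∀ e, E (ext (Fin.snoc d e : Fin (N + 2) → Bool)) ↔ E (ext d) := fun e =>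
    hE _ _ fun i hi => ext_snoc_lt d e (by omega)
  simp_rw [this, pMarkov_snoc]
  rw [← Finset.sum_mul, ← Finset.mul_sum, sum_transD, mul_one]

lemma DepOn.mono {k l : ℕ} {E : (ℕ → Bool) → Prop} (hE : DepOn k E) (h : k ≤ l) : DepOn l E :=
  fun D D' hD => hE D D' fun i hi => hD i (hi.trans h)

lemma DepOn.and {k : ℕ} {E F : (ℕ → Bool) → Prop} (hE : DepOn k E) (hF : DepOn k F) :
    DepOn k fun D => E D ∧ F D :=
  fun D D' hD => and_congr (hE D D' hD) (hF D D' hD)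

lemma depOn_apply {i k : ℕ} (b : Bool) (h : i ≤ k) : DepOn k fun D => D i = b := by
  intro D D' hD
  simp only [hD i h]

lemma depOn_ones {k j l : ℕ} (h : k + j ≤ l) : DepOn l fun D => Ones D k j := by
  intro D D' hD
  exact forall_congr' fun i => forall_congr' fun _ => forall_congr' fun hi => by
    rw [hD i (hi.trans h)]

lemma mProb_eq {k N : ℕ} (h : k ≤ N) {E : (ℕ → Bool) → Prop} (hE : DepOn k E) :
    mProb α β N E = mProb α β k E := by
  induction N, h using Nat.le_induction with
  | base => rfl
  | succ N hN ih => rw [mProb_succ (hE.mono hN), ih]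

lemma mProb_step {k N : ℕ} (h : k + 1 ≤ N) {E : (ℕ → Bool) → Prop} (hE : DepOn k E) (s b : Bool) :
    mProb α β N (fun D => (E D ∧ D k = s) ∧ D (k + 1) = b) =
      transD α β s b * mProb α β N (fun D => E D ∧ D k = s) := by
  have hE' := hE.and (depOn_apply s le_rfl)
  rw [mProb_eq h ((hE'.mono (Nat.le_succ k)).and (depOn_apply b le_rfl)),
    mProb_eq (by omega : k ≤ N) hE']
  unfold mProb
  rw [sum_snoc, Finset.mul_sum]
  refine Finset.sum_congr rfl fun d _ => ?_
  have h1 : ∀ e, (E (ext (Fin.snoc d e : Fin (k + 2) → Bool)) ∧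
      ext (Fin.snoc d e : Fin (k + 2) → Bool) k = s) ↔ (E (ext d) ∧ ext d k = s) := fun e =>
    hE' _ _ fun i hi => ext_snoc_lt d e (by omega)
  simp_rw [h1, ext_snoc_self, pMarkov_snoc, ← ext_last]
  by_cases h2 : E (ext d) ∧ ext d k = s
  · simp only [h2, and_self, true_and]
    cases b <;> simp [mul_comm]
  · simp [h2]

lemma mProb_mono (hα : 0 < α) (hα' : α < 1) (hβ : 0 < β) (hβ' : β < 1) {N : ℕ}
    {E F : (ℕ → Bool) → Prop} (h : ∀ D, E D → F D) : mProb α β N E ≤ mProb α β N F := by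
  refine Finset.sum_le_sum fun d _ =>
    mul_le_mul_of_nonneg_left ?_ (pMarkov_pos hα hα' hβ hβ' d).le
  by_cases h1 : E (ext d)
  · simp [h1, h _ h1]
  · rw [if_neg h1]
    split_ifs <;> norm_num

lemma mProb_nonneg (hα : 0 < α) (hα' : α < 1) (hβ : 0 < β) (hβ' : β < 1) (N : ℕ)
    (E : (ℕ → Bool) → Prop) : 0 ≤ mProb α β N E :=
  Finset.sum_nonneg fun d _ => mul_nonneg (pMarkov_pos hα hα' hβ hβ' d).le (by split_ifs <;> simp)

lemma mProb_le_one (hα : 0 < α) (hα' : α < 1) (hβ : 0 < β) (hβ' : β < 1) (N : ℕ)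
    (E : (ℕ → Bool) → Prop) : mProb α β N E ≤ 1 := by
  refine (mProb_mono hα hα' hβ hβ' (F := fun _ => True) fun _ _ => trivial).trans_eq ?_
  simp [mProb, sum_pMarkov hα hβ]

lemma mProb_zero_true (N : ℕ) : mProb α β N (fun D => D 0 = true) = β / (α + β) := by
  rw [mProb_eq (Nat.zero_le N) (depOn_apply true le_rfl)]
  unfold mProb
  rw [sum_snoc]
  simp only [Nat.reduceAdd, ext_snoc_self]
  simp [pMarkov, initD, Fin.snoc]

lemma ones_zero {D : ℕ → Bool} {k : ℕ} : Ones D k 0 ↔ D k = true :=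
  ⟨fun h => h k le_rfl le_rfl, fun h i h1 h2 => by rwa [(by omega : i = k)]⟩

lemma ones_succ {D : ℕ → Bool} {k j : ℕ} : Ones D k (j + 1) ↔ Ones D k j ∧ D (k + j + 1) = true :=
  ⟨fun h => ⟨fun i h1 h2 => h i h1 (by omega), h _ (by omega) le_rfl⟩, fun h i h1 h2 => by
    rcases (by omega : i ≤ k + j ∨ i = k + j + 1) with h3 | rfl
    · exact h.1 i h1 h3
    · exact h.2⟩

lemma mProb_ones {k j N : ℕ} (h : k + j ≤ N) {E : (ℕ → Bool) → Prop} (hE : DepOn k E) :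
    mProb α β N (fun D => E D ∧ Ones D k j) =
      (1 - α) ^ j * mProb α β N (fun D => E D ∧ D k = true) := by
  induction j with
  | zero => simp [ones_zero]
  | succ j ih =>
    have h1 := mProb_step (α := α) (β := β) (k := k + j) (N := N) (by omega)
      ((hE.mono (Nat.le_add_right k j)).and (depOn_ones le_rfl)) true true
    have h2 : ∀ D, (((E D ∧ Ones D k j) ∧ D (k + j) = true) ∧ D (k + j + 1) = true) ↔
        (E D ∧ Ones D k (j + 1)) := by
      intro D
      rw [ones_succ]
      have : Ones D k j → D (k + j) = true := fun h => h _ (by omega) le_rfl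
      tauto
    have h3 : ∀ D, ((E D ∧ Ones D k j) ∧ D (k + j) = true) ↔ (E D ∧ Ones D k j) := by
      intro D
      have : Ones D k j → D (k + j) = true := fun h => h _ (by omega) le_rfl
      tauto
    simp_rw [h2, h3] at h1
    rw [h1, ih (by omega), pow_succ]
    simp [transD]
    ring

lemma mProb_start (hα : 0 < α) (hα' : α < 1) (hβ : 0 < β) (hβ' : β < 1) {k j N : ℕ}
    (h : k + 1 + j ≤ N) {E : (ℕ → Bool) → Prop} (hE : DepOn k E) :
    mProb α β N (fun D => (E D ∧ D k = false) ∧ Ones D (k + 1) j) ≤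
      β * (1 - α) ^ j * mProb α β N E := by
  rw [mProb_ones h ((hE.and (depOn_apply false le_rfl)).mono (Nat.le_succ k)),
    mProb_step (by omega) hE]
  have h1 : transD α β false true = β := by simp [transD]
  rw [h1, mul_comm β ((1 - α) ^ j), mul_assoc]
  have : 0 ≤ 1 - α := by linarith
  gcongr
  exact mProb_mono hα hα' hβ hβ' fun D hD => hD.1

/-- A maximal run of `j + 1` ones occupies exactly the positions `s + 1, …, s + j + 1`. -/
def IsBurst (D : ℕ → Bool) (s j : ℕ) : Prop :=
  D s = false ∧ Ones D (s + 1) j ∧ D (s + j + 2) = false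

lemma mProb_burst (hα : 0 < α) (hα' : α < 1) (hβ : 0 < β) (hβ' : β < 1) {s j N : ℕ}
    (h : s + j + 2 ≤ N) :
    mProb α β N (fun D => IsBurst D s j) ≤ β * (α * (1 - α) ^ j) := by
  have hdep : DepOn (s + j + 1) (fun D => (True ∧ D s = false) ∧ Ones D (s + 1) j) :=
    ((DepOn.and (k := s) (E := fun _ => True) (fun _ _ _ => Iff.rfl)
      (depOn_apply false le_rfl)).mono (by omega)).and (depOn_ones (by omega))
  have h1 := mProb_step (α := α) (β := β) (N := N) (by omega) hdep true false
  have h2 := mProb_start hα hα' hβ hβ' (k := s) (j := j) (N := N) (by omega)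
    (E := fun _ => True) (fun _ _ _ => Iff.rfl)
  have h3 := mProb_le_one hα hα' hβ hβ' N (fun _ => True)
  have h4 : mProb α β N (fun D => IsBurst D s j) ≤ mProb α β N (fun D =>
      (((True ∧ D s = false) ∧ Ones D (s + 1) j) ∧ D (s + j + 1) = true) ∧
        D (s + j + 1 + 1) = false) :=
    mProb_mono hα hα' hβ hβ' fun D hD =>
      ⟨⟨⟨⟨trivial, hD.1⟩, hD.2.1⟩, hD.2.1 _ (by omega) (by omega)⟩, hD.2.2⟩
  have h5 : transD α β true false = α := by simp [transD]
  have h6 := mProb_mono hα hα' hβ hβ' (N := N)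
    (E := fun D => ((True ∧ D s = false) ∧ Ones D (s + 1) j) ∧ D (s + j + 1) = true)
    (F := fun D => (True ∧ D s = false) ∧ Ones D (s + 1) j) fun D hD => hD.1
  have h7 : 0 ≤ (1 - α) ^ j := pow_nonneg (by linarith) _
  rw [h5] at h1
  calc _ ≤ _ := h4
    _ = _ := h1
    _ ≤ α * (β * (1 - α) ^ j * 1) := by
        gcongr
        exact h6.trans (h2.trans (by gcongr))
    _ = _ := by ring

end Markov

/-- Probability of an event of the uniform source `(X_0, …, X_{n-1})`. -/
def uProb (n : ℕ) (E : (ℕ → Bool) → Prop) : ℝ :=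
  (1 / 2 : ℝ) ^ n * ∑ x : Fin n → Bool, if E (ext x) then 1 else 0

lemma uProb_true (n : ℕ) : uProb n (fun _ => True) = 1 := by
  simp [uProb]

lemma ext_update {n : ℕ} (x : Fin n → Bool) (i : Fin n) (b : Bool) (k : ℕ) :
    ext (Function.update x i b) k = if k = i then b else ext x k := by
  unfold ext
  split_ifs with h1 h2 h3
  · subst h2
    simp
  · rw [Function.update_of_ne]
    rintro rfl
    exact h2 rfl
  · omega
  · rfl

/-- A fresh bit takes a value determined by the earlier bits with probability `1/2`. -/
lemma uProb_half {n i : ℕ} (hi : i < n) {E : (ℕ → Bool) → Prop} (v : (ℕ → Bool) → Bool)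
    (hE : ∀ X X' : ℕ → Bool, (∀ k ≠ i, X k = X' k) → (E X ↔ E X') ∧ v X = v X') :
    uProb n (fun X => E X ∧ X i = v X) = 1 / 2 * uProb n E := by
  have key : uProb n (fun X => E X ∧ X i = v X) = uProb n (fun X => E X ∧ X i ≠ v X) := by
    unfold uProb
    congr 1
    have hinv : Function.Involutive
        (fun x : Fin n → Bool => Function.update x ⟨i, hi⟩ (!x ⟨i, hi⟩)) := by
      intro x
      simp
    rw [← Equiv.sum_comp hinv.toPerm]
    refine Finset.sum_congr rfl fun x _ => ?_
    have h1 := hE (ext (Function.update x ⟨i, hi⟩ (!x ⟨i, hi⟩))) (ext x)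
      (fun k hk => by rw [ext_update, if_neg hk])
    have h2 : ext (Function.update x ⟨i, hi⟩ (!x ⟨i, hi⟩)) i = !ext x i := by
      rw [ext_update]
      simp [ext, hi]
    have h3 : (E (ext (Function.update x ⟨i, hi⟩ (!x ⟨i, hi⟩))) ∧
        ext (Function.update x ⟨i, hi⟩ (!x ⟨i, hi⟩)) i =
          v (ext (Function.update x ⟨i, hi⟩ (!x ⟨i, hi⟩)))) ↔
        (E (ext x) ∧ ext x i ≠ v (ext x)) := by
      rw [h1.1, h1.2, h2]
      cases ext x i <;> cases v (ext x) <;> simp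
    by_cases h4 : E (ext x) ∧ ext x i ≠ v (ext x)
    · rw [if_pos h4]
      exact if_pos (h3.2 h4)
    · rw [if_neg h4]
      exact if_neg (mt h3.1 h4)
  have hsum : uProb n (fun X => E X ∧ X i = v X) + uProb n (fun X => E X ∧ X i ≠ v X) =
      uProb n E := by
    unfold uProb
    rw [← mul_add, ← Finset.sum_add_distrib]
    congr 1
    refine Finset.sum_congr rfl fun x _ => ?_
    by_cases h1 : E (ext x) <;> by_cases h2 : ext x i = v (ext x) <;> simp [h1, h2]
  linarith

lemma uProb_shift {n h a b : ℕ} (hh : 0 < h) (hab : a ≤ b) (hb : b + h ≤ n) (c : ℕ → Bool) :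
    uProb n (fun X => ∀ k, a ≤ k → k < b → X (k + h) = xor (X k) (c k)) =
      (1 / 2 : ℝ) ^ (b - a) := by
  induction b, hab using Nat.le_induction with
  | base =>
    rw [Nat.sub_self, pow_zero, ← uProb_true n]
    congr 1
    funext X
    exact eq_true fun k h1 h2 => absurd h1 (by omega)
  | succ b hb' ih =>
    rw [Nat.succ_sub hb', pow_succ', ← ih (by omega),
      ← uProb_half (n := n) (i := b + h) (by omega) (fun X => xor (X b) (c b))]
    · congr 1
      funext X
      refine propext ⟨fun H => ⟨fun k h1 h2 => H k h1 (by omega), H b hb' (by omega)⟩,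
        fun H k h1 h2 => ?_⟩
      rcases (by omega : k < b ∨ k = b) with h3 | rfl
      · exact H.1 k h1 h3
      · exact H.2
    · intro X X' hX
      refine ⟨forall_congr' fun k => forall_congr' fun h1 => forall_congr' fun h2 => ?_, ?_⟩
      · rw [hX (k + h) (by omega), hX k (by omega)]
      · simp only [hX b (by omega)]

/-- `ℓ` is the first position at which `X` differs from its shift by `h`. -/
def FirstDiff (X : ℕ → Bool) (h ℓ : ℕ) : Prop :=
  (∀ k < ℓ, X (k + h) = X k) ∧ X (ℓ + h) ≠ X ℓ

lemma uProb_firstDiff {n h ℓ : ℕ} (hh : 0 < h) (hb : ℓ + 1 + h ≤ n) :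
    uProb n (fun X => FirstDiff X h ℓ) = (1 / 2 : ℝ) ^ (ℓ + 1) := by
  rw [← Nat.sub_zero (ℓ + 1), ← uProb_shift hh (Nat.zero_le (ℓ + 1)) hb (fun k => decide (k = ℓ))]
  congr 1
  funext X
  refine propext ⟨fun H k _ hk => ?_, fun H => ⟨fun k hk => ?_, ?_⟩⟩
  · rcases (by omega : k < ℓ ∨ k = ℓ) with h3 | rfl
    · simp [H.1 k h3, h3.ne]
    · have := H.2
      revert this
      cases X (k + h) <;> cases X k <;> simp
  · simpa [hk.ne] using H k (Nat.zero_le _) (by omega)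
  · have := H ℓ (Nat.zero_le _) (by omega)
    rw [this]
    cases X ℓ <;> simp

lemma uProb_agree {n h t : ℕ} (hh : 0 < h) (hb : t + h ≤ n) :
    uProb n (fun X => ∀ k < t, X (k + h) = X k) = (1 / 2 : ℝ) ^ t := by
  have := uProb_shift hh (Nat.zero_le t) hb (fun _ => false)
  simpa using this

lemma uProb_two_shifts {n i j s t r : ℕ} (hij : i ≠ j) (hst : s ≤ t) (hi : i ≤ r) (hj : j ≤ r)
    (hb : t + r ≤ n) :
    uProb n (fun X => ∀ k, s ≤ k → k < t → X (k + i) = X (k + j)) = (1 / 2 : ℝ) ^ (t - s) := by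
  wlog hlt : i < j generalizing i j
  · rw [← this hij.symm hj hi (by omega)]
    simp only [eq_comm]
  rw [show t - s = (t + i) - (s + i) by omega,
    ← uProb_shift (h := j - i) (by omega) (by omega : s + i ≤ t + i) (by omega : _ ≤ n)
      (fun _ => false)]
  congr 1
  funext X
  refine propext ⟨fun H k h1 h2 => ?_, fun H k h1 h2 => ?_⟩
  · have := H (k - i) (by omega) (by omega)
    rw [show k - i + i = k by omega, show k - i + j = k + (j - i) by omega] at this
    simp [this]
  · have := H (k + i) (by omega) (by omega)
    rw [show k + i + (j - i) = k + j by omega] at this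
    simp [this]

/-! ### The output of a pattern with a single burst -/

lemma yList_prefix {s j : ℕ} {x d : List Bool} (hl : x.length = d.length)
    (hs : ∀ i < s, d.getD i false = false) (hsj : s + j ≤ d.length)
    (hj : ∀ i, s ≤ i → i < s + j → d.getD i false = true) :
    yList x d = x.take s ++ yList (x.drop (s + j)) (d.drop (s + j)) := by
  induction s generalizing x d with
  | zero =>
    induction j generalizing x d with
    | zero => simp
    | succ j ih =>
      cases x with
      | nil => simp [yList]
      | cons a x =>
        cases d with
        | nil => simp at hl
        | cons e d =>
          have he : e = true := by simpa using hj 0 (by omega) (by omega)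
          subst he
          have := ih (x := x) (d := d) (by simpa using hl) (by simp)
            (by simp at hsj; omega) (fun i h1 h2 => by
              simpa using hj (i + 1) (by omega) (by omega))
          simp only [zero_add] at this ⊢
          rw [List.drop_succ_cons, List.drop_succ_cons, ← List.nil_append (yList (x.drop j) _)]
          simpa [yList] using this
  | succ s ih =>
    cases x with
    | nil => simp [yList]
    | cons a x =>
      cases d with
      | nil => simp at hl
      | cons e d =>
        have he : e = false := by simpa using hs 0 (by omega)
        subst he
        have := ih (x := x) (d := d) (by simpa using hl)
          (fun i h1 => by simpa using hs (i + 1) (by omega))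
          (by simp at hsj; omega) (fun i h1 h2 => by
            simpa using hj (i + 1) (by omega) (by omega))
        rw [show s + 1 + j = s + j + 1 by omega, List.drop_succ_cons, List.drop_succ_cons,
          List.take_succ_cons, List.cons_append, ← this]
        simp [yList]

lemma yList_getD_of_false {t : ℕ} {x d : List Bool} (hl : x.length = d.length)
    (hs : ∀ i < t, d.getD i false = false) {k : ℕ} (hk : k < t) :
    (yList x d).getD k false = x.getD k false := by
  induction x generalizing d t k with
  | nil => simp [yList]
  | cons a x ih =>
    cases d with
    | nil => simp at hl
    | cons e d =>
      have he : e = false := by simpa using hs 0 (by omega)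
      subst he
      have hy : yList (a :: x) (false :: d) = a :: yList x d := by simp [yList]
      rw [hy]
      cases k with
      | zero => simp
      | succ k =>
        simpa using ih (d := d) (t := t - 1) (k := k) (by simpa using hl)
          (fun i hi => by simpa using hs (i + 1) (by omega)) (by omega)

lemma yList_of_false {x d : List Bool} (hl : x.length = d.length)
    (hs : ∀ i < d.length, d.getD i false = false) : yList x d = x := by
  have := yList_prefix (j := 0) hl hs (by simp) (fun i h1 h2 => absurd h1 (by omega))
  rw [this, ← hl]
  simp [yList]

lemma ofFn_succ_getD {n : ℕ} (d : Fin (n + 2) → Bool) {i : ℕ} (hi : i < n) :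
    (List.ofFn fun i : Fin n => d ⟨i.val + 1, by omega⟩).getD i false = ext d (i + 1) := by
  rw [ofFn_getD]
  unfold ext
  rw [dif_pos hi, dif_pos (by omega)]

lemma yOut_getD {n m s j : ℕ} (x : Fin n → Bool) (d : Fin (n + 2) → Bool) (hm : m ≤ n)
    (hsj : s + j ≤ n) (hs : ∀ i, 0 < i → i ≤ s → ext d i = false)
    (hj : ∀ i, s < i → i ≤ s + j → ext d i = true)
    (hz : ∀ i, s + j < i → i ≤ m → ext d i = false) {k : ℕ} (hk : k + j < m) :
    (yOut (x, d)).getD k false = if k < s then ext x k else ext x (k + j) := by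
  unfold yOut
  dsimp only
  rw [yList_prefix (s := s) (j := j) (by simp)
    (fun i hi => by rw [ofFn_succ_getD _ (by omega)]; exact hs _ (by omega) (by omega))
    (by simpa using hsj)
    (fun i h1 h2 => by rw [ofFn_succ_getD _ (by omega)]; exact hj _ (by omega) (by omega))]
  split_ifs with hks
  · rw [List.getD_append _ _ _ _ (by simp; omega), ← ofFn_getD]
    simp only [List.getD_eq_getElem?_getD]
    rw [List.getElem?_take_of_lt hks]
  · rw [List.getD_append_right _ _ _ _ (by simp; omega)]
    have hlen : ((List.ofFn x).take s).length = s := by simp; omega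
    rw [hlen, yList_getD_of_false (t := m - s - j) (by simp)]
    · rw [← ofFn_getD]
      simp only [List.getD_eq_getElem?_getD, List.getElem?_drop]
      rw [show s + j + (k - s) = k + j by omega]
    · intro i hi
      have := ofFn_succ_getD d (i := s + j + i) (by omega)
      simp only [List.getD_eq_getElem?_getD, List.getElem?_drop] at this ⊢
      rw [this]
      exact hz _ (by omega) (by omega)
    · omega

/-! ### The guessing rule and its cost -/

section Guess

variable {β : ℝ} {L r t : ℕ} {X Y : ℕ → Bool}

/-- The output looks as if a burst had started at the first position, and `ℓ + 1` starting
positions of that burst are compatible with it. -/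
def LooksBurst (L r t : ℕ) (X Y : ℕ → Bool) (ℓ : ℕ) : Prop :=
  (∃ j < r, ∀ k < t, Y k = X (k + (j + 1))) ∧ ℓ < L ∧ (∀ k < ℓ, Y k = X k) ∧ Y ℓ ≠ X ℓ

lemma LooksBurst.unique {ℓ ℓ' : ℕ} (h : LooksBurst L r t X Y ℓ) (h' : LooksBurst L r t X Y ℓ') :
    ℓ = ℓ' := by
  rcases lt_trichotomy ℓ ℓ' with h1 | h1 | h1
  · exact absurd (h'.2.2.1 ℓ h1) h.2.2.2
  · exact h1
  · exact absurd (h.2.2.1 ℓ' h1) h'.2.2.2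

/-- Guessed probability that `D_1 = 1`, given `D_0 = d`, the source `X` and the output `Y`. -/
def guess (β : ℝ) (L r t : ℕ) (d : Bool) (X Y : ℕ → Bool) : ℝ :=
  if d then (if ∀ k < t, Y k = X k then β ^ 2 else 1 - β ^ 2)
  else if h : ∃ ℓ, LooksBurst L r t X Y ℓ then (1 - β ^ 2) / ((h.choose : ℝ) + 1) else β ^ 2

lemma guess_of_looksBurst {ℓ : ℕ} (h : LooksBurst L r t X Y ℓ) :
    guess β L r t false X Y = (1 - β ^ 2) / ((ℓ : ℝ) + 1) := by
  have h' : ∃ ℓ, LooksBurst L r t X Y ℓ := ⟨ℓ, h⟩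
  simp only [guess, Bool.false_eq_true, if_false]
  rw [dif_pos h', h'.choose_spec.unique h]

lemma guess_of_not_looksBurst (h : ¬∃ ℓ, LooksBurst L r t X Y ℓ) :
    guess β L r t false X Y = β ^ 2 := by
  simp [guess, h]

lemma guess_of_eq (h : ∀ k < t, Y k = X k) : guess β L r t true X Y = β ^ 2 := by
  simp only [guess, if_true]
  rw [if_pos h]

lemma guess_of_ne (h : ¬∀ k < t, Y k = X k) : guess β L r t true X Y = 1 - β ^ 2 := by
  simp only [guess, if_true]
  rw [if_neg h]

/-- Guessed probability that `D_1 = b`. -/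
def guessBit (β : ℝ) (L r t : ℕ) (b d : Bool) (X Y : ℕ → Bool) : ℝ :=
  if b then guess β L r t d X Y else 1 - guess β L r t d X Y

/-- A bound for the cost of a wrong guess. -/
def maxCost (β : ℝ) (L : ℕ) : ℝ := 2 * (-Real.logb 2 β) + L + 1

lemma logb_two_le {x : ℝ} (hx : 1 ≤ x) : Real.logb 2 x ≤ x := by
  have h := Real.logb_le_logb_of_le one_lt_two (by linarith) (?_ : x ≤ 2 ^ x)
  · rwa [Real.logb_rpow (by norm_num) (by norm_num)] at h
  · have h1 := one_add_mul_self_le_rpow_one_add (s := (1 : ℝ)) (by norm_num) hx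
    norm_num at h1
    linarith

lemma neg_logb_one_sub_le {x : ℝ} (h0 : 0 ≤ x) (h : x ≤ 1 / 2) :
    -Real.logb 2 (1 - x) ≤ 4 * x := by
  have h1 := Real.one_sub_inv_le_log_of_pos (show 0 < 1 - x by linarith)
  have h2 : (1 - x)⁻¹ ≤ 1 + 2 * x := by
    rw [inv_le_comm₀ (by linarith) (by linarith), inv_le_iff_one_le_mul₀ (by linarith)]
    nlinarith
  have h3 : 1 / 2 < Real.log 2 := by linarith [Real.log_two_gt_d9]
  unfold Real.logb
  rw [← neg_div, div_le_iff₀ (by linarith)]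
  nlinarith

lemma neg_logb_sq_le : -Real.logb 2 (β ^ 2) ≤ maxCost β L := by
  rw [Real.logb_pow]
  unfold maxCost
  have : (0 : ℝ) ≤ L := Nat.cast_nonneg L
  push_cast
  linarith

lemma maxCost_ge_one (hβ : 0 < β) (hβ2 : β ^ 2 ≤ 1 / 2) : 1 ≤ maxCost β L := by
  have h1 : Real.logb 2 β ≤ 0 := Real.logb_nonpos one_lt_two hβ.le (by nlinarith)
  have : (0 : ℝ) ≤ L := Nat.cast_nonneg L
  unfold maxCost
  linarith

lemma guess_mem (hβ : 0 < β) (hβ2 : β ^ 2 ≤ 1 / 2) (d : Bool) :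
    0 < guess β L r t d X Y ∧ guess β L r t d X Y ≤ 1 - β ^ 2 := by
  have h0 : 0 < β ^ 2 := by positivity
  cases d
  · by_cases h : ∃ ℓ, LooksBurst L r t X Y ℓ
    · obtain ⟨ℓ, h⟩ := h
      rw [guess_of_looksBurst h]
      have hℓ : (0 : ℝ) ≤ ℓ := Nat.cast_nonneg ℓ
      refine ⟨div_pos (by linarith) (by linarith), div_le_self (by linarith) (by linarith)⟩
    · rw [guess_of_not_looksBurst h]
      constructor <;> linarith
  · by_cases h : ∀ k < t, Y k = X k
    · rw [guess_of_eq h]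
      constructor <;> linarith
    · rw [guess_of_ne h]
      constructor <;> linarith

lemma guessBit_pos (hβ : 0 < β) (hβ2 : β ^ 2 ≤ 1 / 2)
    (b d : Bool) : 0 < guessBit β L r t b d X Y := by
  have h := guess_mem (L := L) (r := r) (t := t) (X := X) (Y := Y) hβ hβ2 d
  have h0 : 0 < β ^ 2 := by positivity
  cases b <;> simp [guessBit] <;> linarith

lemma cost_le_of_ge (hβ : 0 < β) (hβ2 : β ^ 2 ≤ 1 / 2)
    {b d : Bool} (h : 1 - β ^ 2 ≤ guessBit β L r t b d X Y) :
    -Real.logb 2 (guessBit β L r t b d X Y) ≤ 4 * β ^ 2 := by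
  have := Real.logb_le_logb_of_le one_lt_two (by linarith) h
  linarith [neg_logb_one_sub_le (by positivity) hβ2]

lemma neg_logb_looksBurst (hβ : 0 < β) (hβ2 : β ^ 2 ≤ 1 / 2) (ℓ : ℕ) :
    -Real.logb 2 ((1 - β ^ 2) / ((ℓ : ℝ) + 1)) ≤ 4 * β ^ 2 + Real.logb 2 ((ℓ : ℝ) + 1) := by
  rw [Real.logb_div (by linarith) (by positivity)]
  linarith [neg_logb_one_sub_le (by positivity) hβ2]

lemma cost_le_maxCost (hβ : 0 < β) (hβ2 : β ^ 2 ≤ 1 / 2) (b d : Bool) :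
    -Real.logb 2 (guessBit β L r t b d X Y) ≤ maxCost β L := by
  have key : β ^ 2 ≤ guessBit β L r t b d X Y →
      -Real.logb 2 (guessBit β L r t b d X Y) ≤ maxCost β L := fun h => by
    have := Real.logb_le_logb_of_le one_lt_two (by positivity) h
    linarith [neg_logb_sq_le (β := β) (L := L)]
  have hg := guess_mem (L := L) (r := r) (t := t) (X := X) (Y := Y) hβ hβ2 d
  cases b
  · exact key (by simp only [guessBit, Bool.false_eq_true, if_false]; linarith)
  cases d
  · by_cases h : ∃ ℓ, LooksBurst L r t X Y ℓ
    · obtain ⟨ℓ, h⟩ := h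
      simp only [guessBit, if_true]
      rw [guess_of_looksBurst h]
      refine (neg_logb_looksBurst hβ hβ2 ℓ).trans ?_
      have h1 : ((ℓ : ℝ) + 1) ≤ L := by exact_mod_cast h.2.1
      have h2 := logb_two_le (x := (ℓ : ℝ) + 1) (by linarith [Nat.cast_nonneg (α := ℝ) ℓ])
      have h3 : Real.logb 2 β ≤ -(1 / 2) := by
        have := Real.logb_le_logb_of_le one_lt_two (by positivity) hβ2
        rw [Real.logb_pow, Real.logb_div (by norm_num) (by norm_num)] at this
        norm_num at this
        linarith
      unfold maxCost
      linarith
    · exact key (by simp only [guessBit, if_true]; rw [guess_of_not_looksBurst h])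
  · by_cases h : ∀ k < t, Y k = X k
    · exact key (by simp only [guessBit, if_true]; rw [guess_of_eq h])
    · exact key (by simp only [guessBit, if_true]; rw [guess_of_ne h]; linarith)

lemma cost_of_not_looksBurst (hβ : 0 < β) (hβ2 : β ^ 2 ≤ 1 / 2)
    (h : ¬∃ ℓ, LooksBurst L r t X Y ℓ) :
    -Real.logb 2 (guessBit β L r t false false X Y) ≤ 4 * β ^ 2 := by
  refine cost_le_of_ge hβ hβ2 ?_
  simp only [guessBit, Bool.false_eq_true, if_false]
  rw [guess_of_not_looksBurst h]

/-- The cost when the first bit starts a burst. -/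
lemma cost_burst_first (hβ : 0 < β) (hβ2 : β ^ 2 ≤ 1 / 2)
    {j : ℕ} (hj : j < r) (hLt : L ≤ t) (h : ∀ k < t, Y k = X (k + (j + 1)))
    (hne : ¬∀ k < L, X (k + (j + 1)) = X k) :
    ∃ ℓ < L, FirstDiff X (j + 1) ℓ ∧ -Real.logb 2 (guessBit β L r t true false X Y) ≤
      4 * β ^ 2 + Real.logb 2 ((ℓ : ℝ) + 1) := by
  push Not at hne
  obtain ⟨hℓ, hℓ'⟩ := Nat.find_spec hne
  have hmin : ∀ k < Nat.find hne, X (k + (j + 1)) = X k := by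
    intro k hk
    by_contra hk'
    exact Nat.find_min hne hk ⟨hk.trans hℓ, hk'⟩
  have hlb : LooksBurst L r t X Y (Nat.find hne) := by
    refine ⟨⟨j, hj, h⟩, hℓ, fun k hk => ?_, ?_⟩
    · rw [h k (by omega), hmin k hk]
    · rwa [h _ (by omega)]
  refine ⟨Nat.find hne, hℓ, ⟨hmin, hℓ'⟩, ?_⟩
  simp only [guessBit, if_true]
  rw [guess_of_looksBurst hlb]
  exact neg_logb_looksBurst hβ hβ2 _

/-- The cost when a burst starts later. -/
lemma cost_burst_later (hβ : 0 < β) (hβ2 : β ^ 2 ≤ 1 / 2) {s j : ℕ} (hs : 0 < s) (hLt : L ≤ t)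
    (h : ∀ k < t, Y k = if k < s then X k else X (k + (j + 1))) :
    -Real.logb 2 (guessBit β L r t false false X Y) ≤ 4 * β ^ 2 ∨
    (∃ ℓ < L, s ≤ ℓ ∧ FirstDiff X (j + 1) ℓ ∧
      -Real.logb 2 (guessBit β L r t false false X Y) ≤
        Real.logb 2 (((ℓ : ℝ) + 1) / ℓ)) ∨
    (s < L ∧ (∃ i < r, i ≠ j ∧ ∀ k, s ≤ k → k < t → X (k + (i + 1)) = X (k + (j + 1))) ∧
      -Real.logb 2 (guessBit β L r t false false X Y) ≤ 1) := by
  by_cases hlb : ∃ ℓ, LooksBurst L r t X Y ℓ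
  swap
  · exact Or.inl (cost_of_not_looksBurst hβ hβ2 hlb)
  right
  obtain ⟨ℓ, hlb⟩ := hlb
  have hsℓ : s ≤ ℓ := by
    by_contra hlt
    have h1 := h ℓ (lt_of_lt_of_le hlb.2.1 hLt)
    rw [if_pos (by omega)] at h1
    exact hlb.2.2.2 h1
  have hℓ1 : (1 : ℝ) ≤ ℓ := by exact_mod_cast (by omega : 1 ≤ ℓ)
  have hcost : -Real.logb 2 (guessBit β L r t false false X Y) ≤
      Real.logb 2 (((ℓ : ℝ) + 1) / ℓ) := by
    simp only [guessBit, Bool.false_eq_true, if_false]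
    rw [guess_of_looksBurst hlb, ← Real.logb_inv]
    refine Real.logb_le_logb_of_le one_lt_two (inv_pos.2 ?_) ?_
    · rw [sub_pos, div_lt_one (by linarith)]
      linarith [sq_nonneg β]
    · rw [← inv_div (ℓ : ℝ) ((ℓ : ℝ) + 1)]
      refine inv_anti₀ (by positivity) ?_
      rw [div_le_iff₀ (by linarith), sub_mul, div_mul_cancel₀ _ (by linarith)]
      linarith [sq_nonneg β]
  obtain ⟨i, hi, hiY⟩ := hlb.1
  by_cases hij : i = j
  · subst hij
    refine Or.inl ⟨ℓ, hlb.2.1, hsℓ, ⟨fun k hk => ?_, ?_⟩, hcost⟩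
    · rw [← hiY k (by have := hlb.2.1; omega), hlb.2.2.1 k hk]
    · rw [← hiY ℓ (by have := hlb.2.1; omega)]
      exact hlb.2.2.2
  · refine Or.inr ⟨lt_of_le_of_lt hsℓ hlb.2.1, ⟨i, hi, hij, fun k h1 h2 => ?_⟩, hcost.trans ?_⟩
    · rw [← hiY k h2, h k h2, if_neg (by omega)]
    · have h2 : ((ℓ : ℝ) + 1) / ℓ ≤ 2 := by
        rw [div_le_iff₀ (by linarith)]
        linarith
      have h3 := Real.logb_le_logb_of_le one_lt_two (by positivity) h2
      rwa [Real.logb_self_eq_one one_lt_two] at h3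

end Guess

/-! ### Decomposition of the deletion pattern -/

/-- The deletion pattern is atypical on the window `0, …, m`: it has two bursts, or a burst
with more than `r` deletions. -/
def Bad (m r : ℕ) (D : ℕ → Bool) : Prop :=
  (∃ b < m, ∃ a < b, ((D a = false ∧ D (a + 1) = true) ∧ D b = false) ∧ Ones D (b + 1) 0) ∨
  (∃ a < m, (True ∧ D a = false) ∧ Ones D (a + 1) r) ∨
  (∃ b < m, (D 0 = true ∧ D b = false) ∧ Ones D (b + 1) 0) ∨
  (True ∧ Ones D 0 r)

lemma exists_start {D : ℕ → Bool} {a i : ℕ} (ha : D a = false) (hi : a ≤ i) (hDi : D i = true) :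
    ∃ b, a ≤ b ∧ b < i ∧ D b = false ∧ D (b + 1) = true ∧ ∀ k, a ≤ k → k ≤ b → D k = false := by
  have hex : ∃ i, a ≤ i ∧ D i = true := ⟨i, hi, hDi⟩
  obtain ⟨h1, h2⟩ := Nat.find_spec hex
  have hne : Nat.find hex ≠ a := by
    intro h
    rw [h, ha] at h2
    exact absurd h2 (by simp)
  have hle : Nat.find hex ≤ i := Nat.find_min' hex ⟨hi, hDi⟩
  have hmin : ∀ k, a ≤ k → k ≤ Nat.find hex - 1 → D k = false := by
    intro k hk1 hk2
    have := Nat.find_min hex (m := k) (by omega)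
    simpa [hk1] using this
  refine ⟨Nat.find hex - 1, by omega, by omega, hmin _ (by omega) le_rfl, ?_, hmin⟩
  rwa [show Nat.find hex - 1 + 1 = Nat.find hex by omega]

lemma exists_run_end {D : ℕ → Bool} {a r : ℕ} (ha : D a = true) (h : ¬Ones D a r) :
    ∃ j < r, Ones D a j ∧ D (a + j + 1) = false := by
  unfold Ones at h
  push Not at h
  obtain ⟨i, h1, h2, h3⟩ := h
  have hex : ∃ j, D (a + j) = false := ⟨i - a, by
    rw [show a + (i - a) = i by omega]
    simpa using h3⟩
  have hs := Nat.find_spec hex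
  have hne : Nat.find hex ≠ 0 := by
    intro h
    rw [h, add_zero, ha] at hs
    exact absurd hs (by simp)
  have hle : Nat.find hex ≤ i - a := Nat.find_min' hex (by
    rw [show a + (i - a) = i by omega]
    simpa using h3)
  refine ⟨Nat.find hex - 1, by omega, fun k hk1 hk2 => ?_, ?_⟩
  · have := Nat.find_min hex (m := k - a) (by omega)
    rw [show a + (k - a) = k by omega] at this
    simpa using this
  · rwa [show a + (Nat.find hex - 1) + 1 = a + Nat.find hex by omega]

lemma zeros_after {D : ℕ → Bool} {m c : ℕ} (hc : D c = false)
    (h : ∀ b < m, c ≤ b → D b = false → D (b + 1) = true → False) :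
    ∀ i, c ≤ i → i ≤ m → D i = false := by
  intro i h1 h2
  by_contra h3
  obtain ⟨b, hb1, hb2, hb3, hb4, -⟩ := exists_start hc h1 (by simpa using h3)
  exact h b (by omega) hb1 hb3 hb4

/-- If the window is not atypical and `D_0 = 0`, it is free of deletions or has a single burst. -/
lemma window_false {D : ℕ → Bool} {m r : ℕ} (hbad : ¬Bad m r D) (h0 : D 0 = false) :
    (∀ i ≤ m, D i = false) ∨ ∃ s < m, ∃ j < r, IsBurst D s j ∧ (∀ i ≤ s, D i = false) ∧
      ∀ i, s + (j + 1) < i → i ≤ m → D i = false := by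
  by_cases hall : ∀ i ≤ m, D i = false
  · exact Or.inl hall
  right
  push Not at hall
  obtain ⟨i, him, hi⟩ := hall
  obtain ⟨s, -, hs2, hs3, hs4, hs5⟩ := exists_start h0 (Nat.zero_le i) (by simpa using hi)
  obtain ⟨j, hj, hj1, hj2⟩ := exists_run_end (r := r) hs4
    fun h => hbad (Or.inr (Or.inl ⟨s, by omega, ⟨trivial, hs3⟩, h⟩))
  rw [show s + 1 + j + 1 = s + j + 2 by omega] at hj2
  refine ⟨s, by omega, j, hj, ⟨hs3, hj1, hj2⟩, fun k hk => hs5 k (Nat.zero_le k) hk,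
    fun k h1 h2 => ?_⟩
  refine zeros_after (m := m) hj2 (fun b hb1 hb2 hb3 hb4 => hbad (Or.inl ?_)) k (by omega) h2
  exact ⟨b, hb1, s, by omega, ⟨⟨hs3, hs4⟩, hb3⟩, ones_zero.2 hb4⟩

/-- If the window is not atypical and `D_0 = 1`, it has a single burst, at its beginning. -/
lemma window_true {D : ℕ → Bool} {m r : ℕ} (hbad : ¬Bad m r D) (h0 : D 0 = true) :
    ∃ j < r, (∀ i ≤ j, D i = true) ∧ ∀ i, j < i → i ≤ m → D i = false := by
  obtain ⟨j, hj, hj1, hj2⟩ := exists_run_end (r := r) h0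
    fun h => hbad (Or.inr (Or.inr (Or.inr ⟨trivial, h⟩)))
  refine ⟨j, hj, fun i hi => hj1 i (Nat.zero_le i) (by omega), fun i h1 h2 => ?_⟩
  refine zeros_after (m := m) hj2 (fun b hb1 _ hb3 hb4 => hbad (Or.inr (Or.inr (Or.inl ?_))))
    i (by omega) h2
  exact ⟨b, hb1, ⟨h0, hb3⟩, ones_zero.2 hb4⟩

/-! ### The pointwise cost bound -/

/-- The value `c` on the event `E D ∧ F X`, and `0` elsewhere. -/
def charge (E F : (ℕ → Bool) → Prop) (c : ℝ) (D X : ℕ → Bool) : ℝ := if E D ∧ F X then c else 0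

lemma charge_nonneg {E F : (ℕ → Bool) → Prop} {c : ℝ} (hc : 0 ≤ c) (D X : ℕ → Bool) :
    0 ≤ charge E F c D X := by
  unfold charge
  split_ifs <;> simp [hc]

lemma le_charge {E F : (ℕ → Bool) → Prop} {a c : ℝ} {D X : ℕ → Bool} (hE : E D) (hF : F X)
    (h : a ≤ c) : a ≤ charge E F c D X := by
  unfold charge
  rwa [if_pos ⟨hE, hF⟩]

lemma le_sum_of_le {s : Finset ℕ} {f : ℕ → ℝ} (hf : ∀ i ∈ s, 0 ≤ f i) {i : ℕ} (hi : i ∈ s) {c : ℝ}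
    (h : c ≤ f i) : c ≤ ∑ i ∈ s, f i :=
  h.trans (Finset.single_le_sum hf hi)

/-- Charge for a burst starting at the first bit. -/
def chargeFirst (L r : ℕ) (D X : ℕ → Bool) : ℝ :=
  ∑ j ∈ Finset.range r, ∑ ℓ ∈ Finset.range L,
    charge (fun D => IsBurst D 0 j) (fun X => FirstDiff X (j + 1) ℓ)
      (Real.logb 2 ((ℓ : ℝ) + 1)) D X

/-- Charge for a burst starting at the first bit that is not detected. -/
def chargeHidden (β : ℝ) (L r : ℕ) (D X : ℕ → Bool) : ℝ :=
  ∑ j ∈ Finset.range r,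
    charge (fun D => IsBurst D 0 j) (fun X => ∀ k < L, X (k + (j + 1)) = X k) (maxCost β L) D X

/-- Charge for a later burst which might have started at the first bit. -/
def chargeLater (L r : ℕ) (D X : ℕ → Bool) : ℝ :=
  ∑ s ∈ Finset.Ico 1 L, ∑ j ∈ Finset.range r, ∑ ℓ ∈ Finset.Ico s L,
    charge (fun D => IsBurst D s j) (fun X => FirstDiff X (j + 1) ℓ)
      (Real.logb 2 (((ℓ : ℝ) + 1) / ℓ)) D X

/-- Charge for a later burst which resembles one of another length. -/
def chargeMisread (L r t : ℕ) (D X : ℕ → Bool) : ℝ :=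
  ∑ s ∈ Finset.Ico 1 L, ∑ j ∈ Finset.range r, ∑ i ∈ (Finset.range r).erase j,
    charge (fun D => IsBurst D s j)
      (fun X => ∀ k, s ≤ k → k < t → X (k + (i + 1)) = X (k + (j + 1))) 1 D X

/-- Charge for a burst already under way that is not detected. -/
def chargeOngoing (β : ℝ) (L r t : ℕ) (D X : ℕ → Bool) : ℝ :=
  ∑ j ∈ Finset.range r,
    charge (fun D => D 0 = true) (fun X => ∀ k < t, X (k + (j + 1)) = X k) (maxCost β L) D X

/-- Charge for an atypical deletion pattern. -/
def chargeBad (β : ℝ) (L r t : ℕ) (D X : ℕ → Bool) : ℝ :=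
  charge (fun D => Bad (t + r) r D) (fun _ => True) (maxCost β L) D X

section Pointwise

variable {β : ℝ} {L r t : ℕ} {D X : ℕ → Bool}

lemma logb_add_one_nonneg (ℓ : ℕ) : 0 ≤ Real.logb 2 ((ℓ : ℝ) + 1) :=
  Real.logb_nonneg one_lt_two (by linarith [Nat.cast_nonneg (α := ℝ) ℓ])

lemma logb_ratio_nonneg (ℓ : ℕ) : 0 ≤ Real.logb 2 (((ℓ : ℝ) + 1) / ℓ) := by
  rcases Nat.eq_zero_or_pos ℓ with rfl | h
  · simp
  · have : (0 : ℝ) < ℓ := by exact_mod_cast h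
    refine Real.logb_nonneg one_lt_two ?_
    rw [le_div_iff₀ this]
    linarith

lemma chargeFirst_nonneg : 0 ≤ chargeFirst L r D X :=
  Finset.sum_nonneg fun _ _ => Finset.sum_nonneg fun ℓ _ =>
    charge_nonneg (logb_add_one_nonneg ℓ) D X

lemma chargeLater_nonneg : 0 ≤ chargeLater L r D X :=
  Finset.sum_nonneg fun _ _ => Finset.sum_nonneg fun _ _ => Finset.sum_nonneg fun ℓ _ =>
    charge_nonneg (logb_ratio_nonneg ℓ) D X

lemma chargeMisread_nonneg : 0 ≤ chargeMisread L r t D X :=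
  Finset.sum_nonneg fun _ _ => Finset.sum_nonneg fun _ _ => Finset.sum_nonneg fun _ _ =>
    charge_nonneg zero_le_one D X

lemma le_chargeFirst {j ℓ : ℕ} (hj : j < r) (hℓ : ℓ < L) (hD : IsBurst D 0 j)
    (hX : FirstDiff X (j + 1) ℓ) : Real.logb 2 ((ℓ : ℝ) + 1) ≤ chargeFirst L r D X :=
  le_sum_of_le (fun _ _ => Finset.sum_nonneg fun ℓ _ => charge_nonneg (logb_add_one_nonneg ℓ) D X)
    (Finset.mem_range.2 hj) <|
  le_sum_of_le (fun ℓ _ => charge_nonneg (logb_add_one_nonneg ℓ) D X) (Finset.mem_range.2 hℓ) <|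
  le_charge hD hX le_rfl

lemma le_chargeLater {s j ℓ : ℕ} (hs : 0 < s) (hj : j < r) (hsℓ : s ≤ ℓ) (hℓ : ℓ < L)
    (hD : IsBurst D s j) (hX : FirstDiff X (j + 1) ℓ) :
    Real.logb 2 (((ℓ : ℝ) + 1) / ℓ) ≤ chargeLater L r D X :=
  le_sum_of_le (fun _ _ => Finset.sum_nonneg fun _ _ => Finset.sum_nonneg fun ℓ _ =>
    charge_nonneg (logb_ratio_nonneg ℓ) D X) (Finset.mem_Ico.2 ⟨hs, hsℓ.trans_lt hℓ⟩) <|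
  le_sum_of_le (fun _ _ => Finset.sum_nonneg fun ℓ _ => charge_nonneg (logb_ratio_nonneg ℓ) D X)
    (Finset.mem_range.2 hj) <|
  le_sum_of_le (fun ℓ _ => charge_nonneg (logb_ratio_nonneg ℓ) D X)
    (Finset.mem_Ico.2 ⟨hsℓ, hℓ⟩) <|
  le_charge hD hX le_rfl

lemma one_le_chargeMisread {s i j : ℕ} (hs : 0 < s) (hsL : s < L) (hj : j < r) (hi : i < r)
    (hij : i ≠ j) (hD : IsBurst D s j)
    (hX : ∀ k, s ≤ k → k < t → X (k + (i + 1)) = X (k + (j + 1))) :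
    1 ≤ chargeMisread L r t D X :=
  le_sum_of_le (fun _ _ => Finset.sum_nonneg fun _ _ => Finset.sum_nonneg fun _ _ =>
    charge_nonneg zero_le_one D X) (Finset.mem_Ico.2 ⟨hs, hsL⟩) <|
  le_sum_of_le (fun _ _ => Finset.sum_nonneg fun _ _ => charge_nonneg zero_le_one D X)
    (Finset.mem_range.2 hj) <|
  le_sum_of_le (fun _ _ => charge_nonneg zero_le_one D X)
    (Finset.mem_erase.2 ⟨hij, Finset.mem_range.2 hi⟩) <|
  le_charge (F := fun X => ∀ k, s ≤ k → k < t → X (k + (i + 1)) = X (k + (j + 1))) hD hX le_rfl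

/-- The total charge. -/
def regret (β : ℝ) (L r t : ℕ) (D X : ℕ → Bool) : ℝ :=
  4 * β ^ 2 + chargeFirst L r D X + chargeHidden β L r D X + chargeLater L r D X +
    chargeMisread L r t D X + chargeOngoing β L r t D X + chargeBad β L r t D X

lemma cost_le_regret (hβ : 0 < β) (hβ2 : β ^ 2 ≤ 1 / 2) (ht : 0 < t) (hLt : L ≤ t) {n : ℕ}
    (hn : t + r + r ≤ n) (x : Fin n → Bool) (d : Fin (n + 2) → Bool) :
    -Real.logb 2 (guessBit β L r t (ext d 1) (ext d 0) (ext x)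
      (fun k => (yOut (x, d)).getD k false)) ≤ regret β L r t (ext d) (ext x) := by
  set D := ext d with hD
  set X := ext x with hX
  set Y := fun k => (yOut (x, d)).getD k false with hY
  have hB : 0 ≤ maxCost β L := zero_le_one.trans (maxCost_ge_one hβ hβ2)
  have n1 : 0 ≤ 4 * β ^ 2 := by positivity
  have n2 : 0 ≤ chargeFirst L r D X := chargeFirst_nonneg
  have n3 : 0 ≤ chargeHidden β L r D X := Finset.sum_nonneg fun _ _ => charge_nonneg hB D X
  have n4 : 0 ≤ chargeLater L r D X := chargeLater_nonneg
  have n5 : 0 ≤ chargeMisread L r t D X := chargeMisread_nonneg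
  have n6 : 0 ≤ chargeOngoing β L r t D X := Finset.sum_nonneg fun _ _ => charge_nonneg hB D X
  have n7 : 0 ≤ chargeBad β L r t D X := charge_nonneg hB D X
  unfold regret
  by_cases hbad : Bad (t + r) r D
  · have : maxCost β L ≤ chargeBad β L r t D X := le_charge hbad trivial le_rfl
    linarith [cost_le_maxCost (L := L) (r := r) (t := t) (X := X) (Y := Y) hβ hβ2 (D 1) (D 0)]
  rcases h0 : D 0 with _ | _
  · rcases window_false hbad h0 with hz | ⟨s, hs, j, hj, hburst, hz1, hz2⟩
    · have hYX : ∀ k < t + r, Y k = X k := fun k hk =>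
        (yOut_getD (s := 0) (j := 0) (m := t + r) x d (by omega) (by omega)
          (fun i h1 h2 => absurd h1 (by omega)) (fun i h1 h2 => absurd h1 (by omega))
          (fun i _ h2 => hz i h2) (k := k) (by omega)).trans (if_neg (Nat.not_lt_zero k))
      have hnb : ¬∃ ℓ, LooksBurst L r t X Y ℓ := by
        rintro ⟨ℓ, -, hℓ, -, hne⟩
        exact hne (hYX ℓ (by omega))
      rw [hz 1 (by omega)]
      linarith [cost_of_not_looksBurst hβ hβ2 hnb]
    · have hYX : ∀ k < t, Y k = if k < s then X k else X (k + (j + 1)) := fun k hk =>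
        yOut_getD (s := s) (j := j + 1) (m := t + r) x d (by omega) (by omega)
          (fun i h1 h2 => hz1 i h2) (fun i h1 h2 => hburst.2.1 i (by omega) (by omega))
          hz2 (k := k) (by omega)
      rcases Nat.eq_zero_or_pos s with rfl | hs0
      · have h1 : D 1 = true := hburst.2.1 1 (by omega) (by omega)
        rw [h1]
        simp only [Nat.not_lt_zero, if_false] at hYX
        by_cases hag : ∀ k < L, X (k + (j + 1)) = X k
        · have : maxCost β L ≤ chargeHidden β L r D X :=
            le_sum_of_le (fun _ _ => charge_nonneg hB D X) (Finset.mem_range.2 hj) <|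
              le_charge (F := fun X => ∀ k < L, X (k + (j + 1)) = X k) hburst hag le_rfl
          linarith [cost_le_maxCost (L := L) (r := r) (t := t) (X := X) (Y := Y) hβ hβ2 true false]
        · obtain ⟨ℓ, hℓ, hfd, hc⟩ := cost_burst_first hβ hβ2 hj hLt hYX hag
          linarith [le_chargeFirst hj hℓ hburst hfd]
      · rw [hz1 1 (by omega)]
        rcases cost_burst_later (r := r) hβ hβ2 hs0 hLt hYX with
          hc | ⟨ℓ, hℓ, hsℓ, hfd, hc⟩ | ⟨hsL, ⟨i, hi, hij, hag⟩, hc⟩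
        · linarith
        · linarith [le_chargeLater hs0 hj hsℓ hℓ hburst hfd]
        · linarith [one_le_chargeMisread hs0 hsL hj hi hij hburst hag]
  · obtain ⟨j, hj, h1, h2⟩ := window_true hbad h0
    have hYX : ∀ k < t, Y k = X (k + j) := fun k hk =>
      (yOut_getD (s := 0) (j := j) (m := t + r) x d (by omega) (by omega)
        (fun i h1 h2 => absurd h1 (by omega)) (fun i _ h4 => h1 i (by omega))
        (fun i h3 h4 => h2 i (by omega) h4) (k := k) (by omega)).trans
        ((if_neg (Nat.not_lt_zero k)).trans rfl)
    rcases j with _ | j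
    · rw [h2 1 (by omega) (by omega)]
      have : -Real.logb 2 (guessBit β L r t false true X Y) ≤ 4 * β ^ 2 := by
        refine cost_le_of_ge hβ hβ2 ?_
        simp only [guessBit, Bool.false_eq_true, if_false]
        rw [guess_of_eq (X := X) hYX]
      linarith
    · rw [h1 1 (by omega)]
      by_cases hag : ∀ k < t, X (k + (j + 1)) = X k
      · have : maxCost β L ≤ chargeOngoing β L r t D X :=
          le_sum_of_le (fun _ _ => charge_nonneg hB D X)
            (Finset.mem_range.2 (by omega : j < r)) <|
            le_charge (E := fun D => D 0 = true)
              (F := fun X => ∀ k < t, X (k + (j + 1)) = X k) h0 hag le_rfl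
        linarith [cost_le_maxCost (L := L) (r := r) (t := t) (X := X) (Y := Y) hβ hβ2 true true]
      · have hne : ¬∀ k < t, Y k = X k := by
          intro h
          exact hag fun k hk => by rw [← hYX k hk, h k hk]
        have : -Real.logb 2 (guessBit β L r t true true X Y) ≤ 4 * β ^ 2 := by
          refine cost_le_of_ge hβ hβ2 ?_
          simp only [guessBit, if_true]
          rw [guess_of_ne hne]
        linarith

end Pointwise

/-! ### The expected cost -/

/-- Expectation of a function of the deletion pattern and the source. -/
def expect (α β : ℝ) (n : ℕ) (Φ : (ℕ → Bool) → (ℕ → Bool) → ℝ) : ℝ :=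
  ∑ ω, pJoint α β n ω * Φ (ext ω.2) (ext ω.1)

section Expect

variable {α β : ℝ} {n : ℕ}

lemma expect_add (Φ Ψ : (ℕ → Bool) → (ℕ → Bool) → ℝ) :
    expect α β n (fun D X => Φ D X + Ψ D X) = expect α β n Φ + expect α β n Ψ := by
  simp only [expect, mul_add, Finset.sum_add_distrib]

lemma expect_sum (s : Finset ℕ) (Φ : ℕ → (ℕ → Bool) → (ℕ → Bool) → ℝ) :
    expect α β n (fun D X => ∑ i ∈ s, Φ i D X) = ∑ i ∈ s, expect α β n (Φ i) := by
  simp only [expect, Finset.mul_sum]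
  exact Finset.sum_comm

lemma expect_charge (E F : (ℕ → Bool) → Prop) (c : ℝ) :
    expect α β n (fun D X => charge E F c D X) = mProb α β (n + 1) E * (uProb n F * c) := by
  unfold expect
  rw [Fintype.sum_prod_type]
  simp only [mProb, uProb, pJoint, Finset.sum_mul, Finset.mul_sum]
  refine Finset.sum_congr rfl fun x _ => Finset.sum_congr rfl fun d _ => ?_
  unfold charge
  by_cases h1 : E (ext d) <;> by_cases h2 : F (ext x) <;> simp [h1, h2]
  ring

lemma expect_const (hα : 0 < α) (hβ : 0 < β) (c : ℝ) : expect α β n (fun _ _ => c) = c := by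
  rw [expect, ← Finset.sum_mul, sum_pJoint hα hβ, one_mul]

lemma sum_geometric_le (hα' : α < 1) (r : ℕ) : ∑ j ∈ Finset.range r, α * (1 - α) ^ j ≤ 1 := by
  have h : ∑ j ∈ Finset.range r, α * (1 - α) ^ j = 1 - (1 - α) ^ r := by
    have := mul_neg_geom_sum (1 - α) r
    rw [← Finset.mul_sum]
    linarith
  rw [h]
  have : 0 ≤ (1 - α) ^ r := pow_nonneg (by linarith) r
  linarith

lemma expect_chargeOngoing {L r t : ℕ} (hn : t + r ≤ n) :
    expect α β n (chargeOngoing β L r t) =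
      r * (β / (α + β) * ((1 / 2 : ℝ) ^ t * maxCost β L)) := by
  refine (expect_sum _ _).trans ?_
  rw [Finset.sum_congr rfl (g := fun _ => β / (α + β) * ((1 / 2 : ℝ) ^ t * maxCost β L))]
  · simp
  · intro j hj
    rw [Finset.mem_range] at hj
    rw [expect_charge, mProb_zero_true, uProb_agree (by omega) (by omega)]

lemma sum_burst_le (hα : 0 < α) (hα' : α < 1) (hβ : 0 < β) (hβ' : β < 1)
    {s r N : ℕ} (h : s + r + 1 ≤ N) {g : ℕ → ℝ} {G : ℝ} (hG : 0 ≤ G)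
    (hg : ∀ j < r, g j ≤ G) :
    ∑ j ∈ Finset.range r, mProb α β N (fun D => IsBurst D s j) * g j ≤ β * G := by
  calc ∑ j ∈ Finset.range r, mProb α β N (fun D => IsBurst D s j) * g j
      ≤ ∑ j ∈ Finset.range r, β * (α * (1 - α) ^ j) * G := by
        refine Finset.sum_le_sum fun j hj => ?_
        rw [Finset.mem_range] at hj
        exact (mul_le_mul_of_nonneg_left (hg j hj) (mProb_nonneg hα hα' hβ hβ' _ _)).trans
          (mul_le_mul_of_nonneg_right (mProb_burst hα hα' hβ hβ' (by omega)) hG)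
    _ = β * G * ∑ j ∈ Finset.range r, α * (1 - α) ^ j := by
        rw [Finset.mul_sum]
        exact Finset.sum_congr rfl fun j _ => by ring
    _ ≤ β * G := mul_le_of_le_one_right (by positivity) (sum_geometric_le hα' r)

lemma expect_chargeFirst (hα : 0 < α) (hα' : α < 1) (hβ : 0 < β) (hβ' : β < 1)
    {L r : ℕ} (hn : L + r ≤ n) :
    expect α β n (chargeFirst L r) ≤
      β * ∑ ℓ ∈ Finset.range L, (1 / 2 : ℝ) ^ (ℓ + 1) * Real.logb 2 ((ℓ : ℝ) + 1) := by
  have h : expect α β n (chargeFirst L r) = ∑ j ∈ Finset.range r,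
      mProb α β (n + 1) (fun D => IsBurst D 0 j) *
        ∑ ℓ ∈ Finset.range L, (1 / 2 : ℝ) ^ (ℓ + 1) * Real.logb 2 ((ℓ : ℝ) + 1) := by
    refine (expect_sum _ _).trans (Finset.sum_congr rfl fun j hj => ?_)
    rw [expect_sum, Finset.mul_sum]
    refine Finset.sum_congr rfl fun ℓ hℓ => ?_
    rw [Finset.mem_range] at hj hℓ
    rw [expect_charge, uProb_firstDiff (by omega) (by omega)]
  rw [h]
  exact sum_burst_le hα hα' hβ hβ' (by omega)
    (Finset.sum_nonneg fun ℓ _ => mul_nonneg (by positivity) (logb_add_one_nonneg ℓ))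
    fun j _ => le_rfl

lemma expect_chargeHidden (hα : 0 < α) (hα' : α < 1) (hβ : 0 < β) (hβ' : β < 1)
    {L r : ℕ} (hn : L + r ≤ n) (hB : 0 ≤ maxCost β L) :
    expect α β n (chargeHidden β L r) ≤ β * ((1 / 2 : ℝ) ^ L * maxCost β L) := by
  refine (expect_sum _ _).trans_le ?_
  simp_rw [expect_charge]
  refine sum_burst_le hα hα' hβ hβ' (by omega) (by positivity) fun j hj => ?_
  rw [uProb_agree (by omega) (by omega)]

lemma expect_chargeLater (hα : 0 < α) (hα' : α < 1) (hβ : 0 < β) (hβ' : β < 1)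
    {L r : ℕ} (hn : L + L + r ≤ n) :
    expect α β n (chargeLater L r) ≤
      β * ∑ ℓ ∈ Finset.range L, (1 / 2 : ℝ) ^ (ℓ + 1) * (ℓ * Real.logb 2 (((ℓ : ℝ) + 1) / ℓ)) := by
  set f : ℕ → ℝ := fun ℓ => (1 / 2 : ℝ) ^ (ℓ + 1) * Real.logb 2 (((ℓ : ℝ) + 1) / ℓ) with hf
  have hswap : ∑ s ∈ Finset.Ico 1 L, ∑ ℓ ∈ Finset.Ico s L, f ℓ =
      ∑ ℓ ∈ Finset.range L, (1 / 2 : ℝ) ^ (ℓ + 1) * (ℓ * Real.logb 2 (((ℓ : ℝ) + 1) / ℓ)) := by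
    rw [Finset.sum_Ico_Ico_comm]
    have : ∀ ℓ : ℕ, ∑ _s ∈ Finset.Ico 1 (ℓ + 1), f ℓ =
        (1 / 2 : ℝ) ^ (ℓ + 1) * (ℓ * Real.logb 2 (((ℓ : ℝ) + 1) / ℓ)) := fun ℓ => by
      rw [Finset.sum_const, Nat.card_Ico, nsmul_eq_mul, Nat.add_sub_cancel, hf]
      ring
    simp_rw [this]
    refine Finset.sum_subset (fun ℓ hℓ => ?_) fun ℓ hℓ hℓ' => ?_
    · simp only [Finset.mem_Ico, Finset.mem_range] at *
      omega
    · have : ℓ = 0 := by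
        simp only [Finset.mem_Ico, Finset.mem_range] at *
        omega
      simp [this]
  rw [← hswap, Finset.mul_sum]
  refine (expect_sum _ _).trans_le (Finset.sum_le_sum fun s hs => ?_)
  have h : ∀ j ∈ Finset.range r, expect α β n (fun D X => ∑ ℓ ∈ Finset.Ico s L,
      charge (fun D => IsBurst D s j) (fun X => FirstDiff X (j + 1) ℓ)
        (Real.logb 2 (((ℓ : ℝ) + 1) / ℓ)) D X) =
      mProb α β (n + 1) (fun D => IsBurst D s j) * ∑ ℓ ∈ Finset.Ico s L, f ℓ := fun j hj => by
    rw [expect_sum, Finset.mul_sum]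
    refine Finset.sum_congr rfl fun ℓ hℓ => ?_
    rw [Finset.mem_range] at hj
    rw [Finset.mem_Ico] at hℓ
    rw [expect_charge, uProb_firstDiff (by omega) (by omega)]
  rw [expect_sum, Finset.sum_congr rfl h]
  rw [Finset.mem_Ico] at hs
  exact sum_burst_le hα hα' hβ hβ' (by omega)
    (Finset.sum_nonneg fun ℓ _ => mul_nonneg (by positivity) (logb_ratio_nonneg ℓ))
    fun j _ => le_rfl

lemma expect_chargeMisread (hα : 0 < α) (hα' : α < 1) (hβ : 0 < β) (hβ' : β < 1)
    {L r t : ℕ} (hLt : L ≤ t) (hn : t + r ≤ n) :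
    expect α β n (chargeMisread L r t) ≤ L * (β * (r * (1 / 2 : ℝ) ^ (t - L))) := by
  have hs : ∀ s ∈ Finset.Ico 1 L, expect α β n (fun D X => ∑ j ∈ Finset.range r,
      ∑ i ∈ (Finset.range r).erase j, charge (fun D => IsBurst D s j)
        (fun X => ∀ k, s ≤ k → k < t → X (k + (i + 1)) = X (k + (j + 1))) 1 D X) ≤
      β * (r * (1 / 2 : ℝ) ^ (t - L)) := fun s hs => by
    rw [Finset.mem_Ico] at hs
    have h : ∀ j ∈ Finset.range r, expect α β n (fun D X => ∑ i ∈ (Finset.range r).erase j,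
        charge (fun D => IsBurst D s j)
          (fun X => ∀ k, s ≤ k → k < t → X (k + (i + 1)) = X (k + (j + 1))) 1 D X) =
        mProb α β (n + 1) (fun D => IsBurst D s j) *
          ∑ i ∈ (Finset.range r).erase j, (1 / 2 : ℝ) ^ (t - s) := fun j hj => by
      rw [expect_sum, Finset.mul_sum]
      refine Finset.sum_congr rfl fun i hi => ?_
      rw [Finset.mem_erase] at hi
      rw [Finset.mem_range] at hi hj
      rw [expect_charge, uProb_two_shifts (r := r) (by omega) (by omega) (by omega) (by omega) hn,
        mul_one]
    rw [expect_sum, Finset.sum_congr rfl h]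
    refine sum_burst_le hα hα' hβ hβ' (by omega) (by positivity) fun j hj => ?_
    rw [Finset.sum_const, nsmul_eq_mul]
    have h1 : (((Finset.range r).erase j).card : ℝ) ≤ r := by
      exact_mod_cast (Finset.card_erase_le).trans (Finset.card_range r).le
    exact mul_le_mul h1 (pow_le_pow_of_le_one (by norm_num) (by norm_num) (by omega))
      (by positivity) (by positivity)
  refine (expect_sum _ _).trans_le ((Finset.sum_le_sum hs).trans ?_)
  rw [Finset.sum_const, nsmul_eq_mul, Nat.card_Ico]
  gcongr
  omega

lemma mProb_or_le (hα : 0 < α) (hα' : α < 1) (hβ : 0 < β) (hβ' : β < 1)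
    (N : ℕ) (E F : (ℕ → Bool) → Prop) :
    mProb α β N (fun D => E D ∨ F D) ≤ mProb α β N E + mProb α β N F := by
  unfold mProb
  rw [← Finset.sum_add_distrib]
  refine Finset.sum_le_sum fun d _ => ?_
  rw [← mul_add]
  refine mul_le_mul_of_nonneg_left ?_ (pMarkov_pos hα hα' hβ hβ' d).le
  by_cases h1 : E (ext d) <;> by_cases h2 : F (ext d) <;> simp [h1, h2]

lemma mProb_exists_le (hα : 0 < α) (hα' : α < 1) (hβ : 0 < β) (hβ' : β < 1)
    (N m : ℕ) (E : ℕ → (ℕ → Bool) → Prop) :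
    mProb α β N (fun D => ∃ b < m, E b D) ≤ ∑ b ∈ Finset.range m, mProb α β N (E b) := by
  unfold mProb
  rw [Finset.sum_comm]
  refine Finset.sum_le_sum fun d _ => ?_
  rw [← Finset.mul_sum]
  refine mul_le_mul_of_nonneg_left ?_ (pMarkov_pos hα hα' hβ hβ' d).le
  split_ifs with h
  · obtain ⟨b, hb, hE⟩ := h
    exact le_sum_of_le (fun b _ => by split_ifs <;> simp) (Finset.mem_range.2 hb) (by simp [hE])
  · exact Finset.sum_nonneg fun b _ => by split_ifs <;> simp

lemma mProb_bad_le (hα : 0 < α) (hα' : α < 1) (hβ : 0 < β) (hβ' : β < 1)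
    {m r N : ℕ} (hN : m + r ≤ N) :
    mProb α β N (Bad m r) ≤ m ^ 2 * β ^ 2 + m * (β * (1 - α) ^ r) + m * (β * (β / (α + β))) +
      (1 - α) ^ r * (β / (α + β)) := by
  have h1 : mProb α β N (fun D => ∃ b < m, ∃ a < b,
      ((D a = false ∧ D (a + 1) = true) ∧ D b = false) ∧ Ones D (b + 1) 0) ≤ m ^ 2 * β ^ 2 := by
    have hab : ∀ b < m, ∀ a < b, mProb α β N (fun D =>
        ((D a = false ∧ D (a + 1) = true) ∧ D b = false) ∧ Ones D (b + 1) 0) ≤ β ^ 2 := by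
      intro b hb a ha
      have h2 := mProb_start hα hα' hβ hβ' (k := b) (j := 0) (N := N) (by omega)
        ((depOn_apply (i := a) false (by omega)).and (depOn_apply (i := a + 1) true (by omega)))
      have h3 := mProb_start hα hα' hβ hβ' (k := a) (j := 0) (N := N) (by omega)
        (E := fun _ => True) fun _ _ _ => Iff.rfl
      have h4 : mProb α β N (fun D => D a = false ∧ D (a + 1) = true) ≤
          mProb α β N (fun D => (True ∧ D a = false) ∧ Ones D (a + 1) 0) :=
        mProb_mono hα hα' hβ hβ' fun D h => ⟨⟨trivial, h.1⟩, ones_zero.2 h.2⟩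
      have h5 := mProb_le_one hα hα' hβ hβ' N (fun _ => True)
      rw [pow_zero, mul_one] at h2 h3
      nlinarith
    refine (mProb_exists_le hα hα' hβ hβ' N m _).trans ?_
    calc _ ≤ ∑ _b ∈ Finset.range m, m * β ^ 2 := by
          refine Finset.sum_le_sum fun b hb => (mProb_exists_le hα hα' hβ hβ' N b _).trans ?_
          rw [Finset.mem_range] at hb
          refine (Finset.sum_le_sum fun a ha => hab b hb a (Finset.mem_range.1 ha)).trans ?_
          rw [Finset.sum_const, nsmul_eq_mul, Finset.card_range]
          gcongr
      _ = m ^ 2 * β ^ 2 := by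
          rw [Finset.sum_const, nsmul_eq_mul, Finset.card_range]
          ring
  have h2 : mProb α β N (fun D => ∃ a < m, (True ∧ D a = false) ∧ Ones D (a + 1) r) ≤
      m * (β * (1 - α) ^ r) := by
    refine (mProb_exists_le hα hα' hβ hβ' N m _).trans ?_
    refine (Finset.sum_le_sum (g := fun _ => β * (1 - α) ^ r) fun a ha => ?_).trans_eq (by simp)
    rw [Finset.mem_range] at ha
    refine (mProb_start hα hα' hβ hβ' (E := fun _ => True) (by omega)
      fun _ _ _ => Iff.rfl).trans ?_
    exact mul_le_of_le_one_right (mul_nonneg hβ.le (pow_nonneg (by linarith) r))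
      (mProb_le_one hα hα' hβ hβ' N _)
  have h3 : mProb α β N (fun D => ∃ b < m, (D 0 = true ∧ D b = false) ∧ Ones D (b + 1) 0) ≤
      m * (β * (β / (α + β))) := by
    refine (mProb_exists_le hα hα' hβ hβ' N m _).trans ?_
    refine (Finset.sum_le_sum (g := fun _ => β * (β / (α + β))) fun b hb => ?_).trans_eq (by simp)
    rw [Finset.mem_range] at hb
    have := mProb_start hα hα' hβ hβ' (k := b) (j := 0) (N := N) (by omega)
      (depOn_apply (i := 0) true (by omega))
    rwa [mProb_zero_true, pow_zero, mul_one] at this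
  have h4 : mProb α β N (fun D => True ∧ Ones D 0 r) = (1 - α) ^ r * (β / (α + β)) := by
    rw [mProb_ones (E := fun _ => True) (by omega) fun _ _ _ => Iff.rfl, ← mProb_zero_true N]
    simp only [true_and]
  have h5 := mProb_or_le hα hα' hβ hβ' N
    (fun D => ∃ b < m, ∃ a < b, ((D a = false ∧ D (a + 1) = true) ∧ D b = false) ∧
      Ones D (b + 1) 0)
    (fun D => (∃ a < m, (True ∧ D a = false) ∧ Ones D (a + 1) r) ∨
      (∃ b < m, (D 0 = true ∧ D b = false) ∧ Ones D (b + 1) 0) ∨ (True ∧ Ones D 0 r))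
  have h6 := mProb_or_le hα hα' hβ hβ' N
    (fun D => ∃ a < m, (True ∧ D a = false) ∧ Ones D (a + 1) r)
    (fun D => (∃ b < m, (D 0 = true ∧ D b = false) ∧ Ones D (b + 1) 0) ∨ (True ∧ Ones D 0 r))
  have h7 := mProb_or_le hα hα' hβ hβ' N
    (fun D => ∃ b < m, (D 0 = true ∧ D b = false) ∧ Ones D (b + 1) 0)
    (fun D => True ∧ Ones D 0 r)
  have h8 : mProb α β N (Bad m r) = mProb α β N (fun D =>
    (∃ b < m, ∃ a < b, ((D a = false ∧ D (a + 1) = true) ∧ D b = false) ∧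
      Ones D (b + 1) 0) ∨ (∃ a < m, (True ∧ D a = false) ∧ Ones D (a + 1) r) ∨
      (∃ b < m, (D 0 = true ∧ D b = false) ∧ Ones D (b + 1) 0) ∨ (True ∧ Ones D 0 r)) := rfl
  linarith

lemma Eseq_le_expect (hα : 0 < α) (hα' : α < 1) (hβ : 0 < β) (hβ' : β < 1)
    (hβ2 : β ^ 2 ≤ 1 / 2) {L r t : ℕ} (ht : 0 < t) (hLt : L ≤ t)
    (hn : t + r + r ≤ n) : Eseq α β n ≤ expect α β n (regret β L r t) := by
  refine (condEnt_le_cost (fun ω => (pJoint_pos hα hα' hβ hβ' ω).le) (fun ω => ω.2 1)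
    (fun ω => (ω.2 0, ω.1, yOut ω, ω.2 (Fin.last (n + 1))))
    (fun b z => guessBit β L r t b z.1 (ext z.2.1) (fun k => z.2.2.1.getD k false))
    (fun b z => guessBit_pos hβ hβ2 b z.1) (fun z => by simp [guessBit])).trans ?_
  exact Finset.sum_le_sum fun ω _ => mul_le_mul_of_nonneg_left
    (cost_le_regret hβ hβ2 ht hLt hn ω.1 ω.2) (pJoint_pos hα hα' hβ hβ' ω).le

/-- The truncated main term. -/
def mainTerm (L : ℕ) : ℝ := ∑ ℓ ∈ Finset.range L, (1 / 2 : ℝ) ^ (ℓ + 1) *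
  (Real.logb 2 ((ℓ : ℝ) + 1) + ℓ * Real.logb 2 (((ℓ : ℝ) + 1) / ℓ))

lemma Eseq_le (hα : 0 < α) (hα' : α < 1) (hβ : 0 < β) (hβ' : β < 1)
    (hβ2 : β ^ 2 ≤ 1 / 2) {L r t : ℕ} (ht : 0 < t) (hLt : L + L ≤ t)
    (hn : t + r + r ≤ n) :
    Eseq α β n ≤ β * mainTerm L + (4 * β ^ 2 + β * ((1 / 2 : ℝ) ^ L * maxCost β L) +
      L * (β * (r * (1 / 2 : ℝ) ^ (t - L))) +
      r * (β / (α + β) * ((1 / 2 : ℝ) ^ t * maxCost β L)) +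
      (((t + r : ℕ) : ℝ) ^ 2 * β ^ 2 + ((t + r : ℕ) : ℝ) * (β * (1 - α) ^ r) +
        ((t + r : ℕ) : ℝ) * (β * (β / (α + β))) + (1 - α) ^ r * (β / (α + β))) *
        maxCost β L) := by
  have hB : 0 ≤ maxCost β L := zero_le_one.trans (maxCost_ge_one hβ hβ2)
  refine (Eseq_le_expect hα hα' hβ hβ' hβ2 ht (by omega : L ≤ t) hn).trans ?_
  have hsplit : expect α β n (regret β L r t) = 4 * β ^ 2 + expect α β n (chargeFirst L r) +
      expect α β n (chargeHidden β L r) + expect α β n (chargeLater L r) +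
      expect α β n (chargeMisread L r t) + expect α β n (chargeOngoing β L r t) +
      expect α β n (chargeBad β L r t) := by
    unfold regret
    simp only [expect_add, expect_const hα hβ]
  have hbad : expect α β n (chargeBad β L r t) = mProb α β (n + 1) (Bad (t + r) r) *
      maxCost β L := by
    refine (expect_charge _ _ _).trans ?_
    rw [uProb_true, one_mul]
  have hmain : β * mainTerm L =
      β * ∑ ℓ ∈ Finset.range L, (1 / 2 : ℝ) ^ (ℓ + 1) * Real.logb 2 ((ℓ : ℝ) + 1) +
      β * ∑ ℓ ∈ Finset.range L,
        (1 / 2 : ℝ) ^ (ℓ + 1) * (ℓ * Real.logb 2 (((ℓ : ℝ) + 1) / ℓ)) := by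
    rw [← mul_add, ← Finset.sum_add_distrib]
    simp only [mainTerm, mul_add]
  have h1 := expect_chargeFirst hα hα' hβ hβ' (L := L) (r := r) (n := n) (by omega)
  have h2 := expect_chargeHidden hα hα' hβ hβ' (L := L) (r := r) (n := n) (by omega) hB
  have h3 := expect_chargeLater hα hα' hβ hβ' (L := L) (r := r) (n := n) (by omega)
  have h4 := expect_chargeMisread hα hα' hβ hβ' (L := L) (r := r) (t := t) (n := n)
    (by omega) (by omega)
  have h5 := expect_chargeOngoing (α := α) (β := β) (L := L) (r := r) (t := t) (n := n) (by omega)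
  have h6 := mul_le_mul_of_nonneg_right
    (mProb_bad_le hα hα' hβ hβ' (m := t + r) (r := r) (N := n + 1) (by omega)) hB
  rw [hsplit, hbad, hmain]
  linarith

end Expect

/-! ### The constant -/

lemma sq_le_four_mul_pow (l : ℕ) : (l : ℝ) ^ 2 ≤ 4 * (3 / 2 : ℝ) ^ l := by
  rcases le_or_gt l 5 with h | h
  · interval_cases l <;> norm_num
  · induction l, h.le using Nat.le_induction with
    | base => norm_num
    | succ l hl ih =>
      have hl' : (5 : ℝ) ≤ l := by exact_mod_cast hl
      have h1 : (l : ℝ) ^ 2 ≤ 4 * (3 / 2 : ℝ) ^ l := by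
        rcases hl.eq_or_lt with rfl | h2
        · norm_num
        · exact ih h2
      rw [pow_succ (3 / 2 : ℝ)]
      push_cast
      nlinarith

lemma mul_logb_nonneg (l : ℕ) : 0 ≤ (l : ℝ) * Real.logb 2 l := by
  rcases Nat.eq_zero_or_pos l with rfl | h
  · simp
  · exact mul_nonneg (Nat.cast_nonneg l) (Real.logb_nonneg one_lt_two (by exact_mod_cast h))

lemma mul_logb_le (l : ℕ) : (l : ℝ) * Real.logb 2 l ≤ 4 * (3 / 2 : ℝ) ^ l := by
  refine le_trans ?_ (sq_le_four_mul_pow l)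
  rcases Nat.eq_zero_or_pos l with rfl | h
  · simp
  · rw [sq]
    exact mul_le_mul_of_nonneg_left (logb_two_le (by exact_mod_cast h)) (Nat.cast_nonneg l)

lemma mainTerm_eq (L : ℕ) :
    mainTerm L = ∑ l ∈ Finset.range L, (1 / 2 : ℝ) ^ (l + 1) * (l * Real.logb 2 l) +
      (1 / 2 : ℝ) ^ L * (L * Real.logb 2 L) := by
  induction L with
  | zero => simp [mainTerm]
  | succ L ih =>
    have h : mainTerm (L + 1) = mainTerm L + (1 / 2 : ℝ) ^ (L + 1) *
        (Real.logb 2 ((L : ℝ) + 1) + L * Real.logb 2 (((L : ℝ) + 1) / L)) :=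
      Finset.sum_range_succ _ _
    have h2 : (L : ℝ) * Real.logb 2 (((L : ℝ) + 1) / L) =
        L * Real.logb 2 ((L : ℝ) + 1) - L * Real.logb 2 L := by
      rcases Nat.eq_zero_or_pos L with rfl | hL
      · simp
      · have hL' : (L : ℝ) ≠ 0 := by exact_mod_cast hL.ne'
        rw [Real.logb_div (by positivity) hL']
        ring
    rw [h, ih, h2, Finset.sum_range_succ]
    push_cast
    ring

lemma abs_mainTerm_sub_le (L : ℕ) : |mainTerm L - Cconst| ≤ 12 * (3 / 4 : ℝ) ^ L := by
  have hterm : ∀ l : ℕ, (2 : ℝ) ^ (-(l : ℝ) - 1) * (l : ℝ) * Real.logb 2 (l : ℝ) =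
      (1 / 2 : ℝ) ^ (l + 1) * (l * Real.logb 2 l) := fun l => by
    rw [show -(l : ℝ) - 1 = -((l + 1 : ℕ) : ℝ) by push_cast; ring, Real.rpow_neg (by norm_num),
      Real.rpow_natCast, one_div, inv_pow, mul_assoc]
  have hpow : ∀ l : ℕ, (1 / 2 : ℝ) ^ l * (4 * (3 / 2 : ℝ) ^ l) = 4 * (3 / 4 : ℝ) ^ l := fun l => by
    rw [mul_left_comm, ← mul_pow]
    norm_num
  have hbound : ∀ l : ℕ, ‖(1 / 2 : ℝ) ^ (l + 1) * (l * Real.logb 2 l)‖ ≤ 2 * (3 / 4 : ℝ) ^ l := by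
    intro l
    rw [Real.norm_of_nonneg (mul_nonneg (by positivity) (mul_logb_nonneg l))]
    have := mul_le_mul_of_nonneg_left (mul_logb_le l) (by positivity : 0 ≤ (1 / 2 : ℝ) ^ l)
    rw [hpow] at this
    rw [pow_succ]
    linarith
  have hsum : HasSum (fun l : ℕ => (1 / 2 : ℝ) ^ (l + 1) * (l * Real.logb 2 l)) Cconst := by
    have : Summable (fun l : ℕ => (1 / 2 : ℝ) ^ (l + 1) * (l * Real.logb 2 l)) :=
      Summable.of_norm_bounded ((summable_geometric_of_lt_one (by norm_num) (by norm_num :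
        (3 / 4 : ℝ) < 1)).mul_left 2) hbound
    unfold Cconst
    simp_rw [hterm]
    exact this.hasSum
  have h1 := norm_sub_le_of_geometric_bound_of_hasSum (by norm_num : (3 / 4 : ℝ) < 1) hbound hsum L
  rw [Real.norm_eq_abs, abs_le, show (1 : ℝ) - 3 / 4 = 1 / 4 by norm_num] at h1
  have h2 := mul_le_mul_of_nonneg_left (mul_logb_le L) (by positivity : 0 ≤ (1 / 2 : ℝ) ^ L)
  rw [hpow] at h2
  have h3 : 0 ≤ (1 / 2 : ℝ) ^ L * (L * Real.logb 2 L) :=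
    mul_nonneg (by positivity) (mul_logb_nonneg L)
  have h4 : (0 : ℝ) ≤ (3 / 4) ^ L := by positivity
  rw [mainTerm_eq, abs_le]
  constructor <;> linarith [h1.1, h1.2]

/-! ### The lower bound -/

/-- The deletion pattern with the single burst `s + 1, …, s + j + 1`. -/
def pat (n s j : ℕ) (i : Fin (n + 2)) : Bool := decide (s < i.val ∧ i.val ≤ s + j + 1)

/-- A lower bound for the probability of `pat n s j`. -/
def patWeight (α β : ℝ) (n j : ℕ) : ℝ :=
  α / (α + β) * (β * (α * (1 - α) ^ j) * (1 - β) ^ (n + 1))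

lemma ext_pat {n s j i : ℕ} (hi : i < n + 2) :
    ext (pat n s j) i = decide (s < i ∧ i ≤ s + j + 1) := by
  unfold ext
  rw [dif_pos hi]
  rfl

lemma pat_injective {n s s' j : ℕ} (hs : s ≤ n) (hs' : s' ≤ n) (h : pat n s j = pat n s' j) :
    s = s' := by
  have h1 : ext (pat n s j) (s + 1) = ext (pat n s' j) (s + 1) := by rw [h]
  have h2 : ext (pat n s j) (s' + 1) = ext (pat n s' j) (s' + 1) := by rw [h]
  rw [ext_pat (by omega), ext_pat (by omega), decide_eq_decide] at h1 h2
  omega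

lemma patWeight_le {α β : ℝ} (hα : 0 < α) (hα' : α < 1) (hβ : 0 < β) (hβ' : β < 1) {n s j : ℕ}
    (h : s + j + 1 ≤ n) : patWeight α β n j ≤ pMarkov α β (pat n s j) := by
  unfold patWeight pMarkov
  have h0 : initD α β (pat n s j 0) = α / (α + β) := by simp [initD, pat]
  rw [h0]
  refine mul_le_mul_of_nonneg_left ?_ (by positivity)
  have hprod : ∏ i ∈ Finset.range (n + 1), ((if i = s then β else 1) *
      (if i = s + j + 1 then α else 1) * (if i ∈ Finset.Ioc s (s + j) then 1 - α else 1) *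
      (1 - β)) = β * (α * (1 - α) ^ j) * (1 - β) ^ (n + 1) := by
    simp only [Finset.prod_mul_distrib, Finset.prod_ite_eq', Finset.mem_range, Finset.prod_const,
      Finset.card_range]
    rw [if_pos (by omega), if_pos (by omega), Finset.prod_ite_mem, Finset.inter_eq_right.2,
      Finset.prod_const, Nat.card_Ioc, Nat.add_sub_cancel_left]
    · ring
    · intro i hi
      rw [Finset.mem_Ioc] at hi
      rw [Finset.mem_range]
      omega
  rw [← hprod, ← Fin.prod_univ_eq_prod_range]
  have hβ1 : 0 < 1 - β := by linarith
  have hα1 : 0 < 1 - α := by linarith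
  refine Finset.prod_le_prod (fun i _ => ?_) fun i _ => ?_
  · split_ifs <;> positivity
  · have hi := i.isLt
    have e1 : pat n s j i.castSucc = decide (s < i.val ∧ i.val ≤ s + j + 1) := rfl
    have e2 : pat n s j i.succ = decide (s < i.val + 1 ∧ i.val + 1 ≤ s + j + 1) := rfl
    rw [e1, e2]
    rcases (by omega : i.val < s ∨ i.val = s ∨ (s < i.val ∧ i.val ≤ s + j) ∨ i.val = s + j + 1 ∨
      s + j + 1 < i.val) with h1 | h1 | h1 | h1 | h1
    · have a1 : ¬(s < i.val ∧ i.val ≤ s + j + 1) := by omega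
      have a2 : ¬(s < i.val + 1 ∧ i.val + 1 ≤ s + j + 1) := by omega
      have a3 : i.val ∉ Finset.Ioc s (s + j) := by rw [Finset.mem_Ioc]; omega
      rw [if_neg (by omega), if_neg (by omega), if_neg a3, decide_eq_false a1, decide_eq_false a2]
      simp [transD]
    · have a1 : ¬(s < i.val ∧ i.val ≤ s + j + 1) := by omega
      have a2 : s < i.val + 1 ∧ i.val + 1 ≤ s + j + 1 := by omega
      have a3 : i.val ∉ Finset.Ioc s (s + j) := by rw [Finset.mem_Ioc]; omega
      rw [if_pos h1, if_neg (by omega), if_neg a3, decide_eq_false a1, decide_eq_true a2]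
      simp only [transD, Bool.false_eq_true, if_false, if_true, mul_one]
      exact mul_le_of_le_one_right hβ.le (by linarith)
    · have a1 : s < i.val ∧ i.val ≤ s + j + 1 := by omega
      have a2 : s < i.val + 1 ∧ i.val + 1 ≤ s + j + 1 := by omega
      have a3 : i.val ∈ Finset.Ioc s (s + j) := by rw [Finset.mem_Ioc]; omega
      rw [if_neg (by omega), if_neg (by omega), if_pos a3, decide_eq_true a1, decide_eq_true a2]
      simp only [transD, if_true, one_mul]
      exact mul_le_of_le_one_right hα1.le (by linarith)
    · have a1 : s < i.val ∧ i.val ≤ s + j + 1 := by omega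
      have a2 : ¬(s < i.val + 1 ∧ i.val + 1 ≤ s + j + 1) := by omega
      have a3 : i.val ∉ Finset.Ioc s (s + j) := by rw [Finset.mem_Ioc]; omega
      rw [if_neg (by omega), if_pos h1, if_neg a3, decide_eq_true a1, decide_eq_false a2]
      simp only [transD, Bool.false_eq_true, if_false, if_true, one_mul, mul_one]
      exact mul_le_of_le_one_right hα.le (by linarith)
    · have a1 : ¬(s < i.val ∧ i.val ≤ s + j + 1) := by omega
      have a2 : ¬(s < i.val + 1 ∧ i.val + 1 ≤ s + j + 1) := by omega
      have a3 : i.val ∉ Finset.Ioc s (s + j) := by rw [Finset.mem_Ioc]; omega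
      rw [if_neg (by omega), if_neg (by omega), if_neg a3, decide_eq_false a1, decide_eq_false a2]
      simp [transD]

lemma take_append_drop_shift {x : List Bool} {h s : ℕ} (hs : s + h ≤ x.length)
    (hk : ∀ k < s, x.getD (k + h) false = x.getD k false) :
    x.take s ++ x.drop (s + h) = x.drop h := by
  induction s with
  | zero => simp
  | succ s ih =>
    rw [← ih (by omega) fun k h1 => hk k (by omega),
      List.drop_eq_getElem_cons (i := s + h) (by omega),
      List.take_succ_eq_append_getElem (by omega), List.append_assoc]
    have := hk s (by omega)
    rw [List.getD_eq_getElem _ _ (by omega), List.getD_eq_getElem _ _ (by omega)] at this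
    rw [this, show s + 1 + h = s + h + 1 by omega]
    rfl

lemma yOut_pat {n s j : ℕ} (x : Fin n → Bool) (h : s + j + 1 ≤ n)
    (hk : ∀ k < s, ext x (k + (j + 1)) = ext x k) :
    yOut (x, pat n s j) = (List.ofFn x).drop (j + 1) := by
  unfold yOut
  dsimp only
  rw [yList_prefix (s := s) (j := j + 1) (by simp)
    (fun i hi => by rw [ofFn_succ_getD _ (by omega), ext_pat (by omega)]; simp; omega)
    (by simp; omega)
    (fun i h1 h2 => by rw [ofFn_succ_getD _ (by omega), ext_pat (by omega)]; simp; omega),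
    yList_of_false (by simp), take_append_drop_shift (by simp; omega)]
  · intro k hk'
    rw [ofFn_getD, ofFn_getD, hk k hk']
  · intro i hi
    rw [List.length_drop, List.length_ofFn] at hi
    have := ofFn_succ_getD (pat n s j) (i := s + (j + 1) + i) (by omega)
    rw [List.getD_eq_getElem?_getD] at this ⊢
    rw [List.getElem?_drop, this, ext_pat (by omega)]
    simp
    omega

lemma sum_le_prob {Ω ι : Type} [Fintype Ω] {p : Ω → ℝ} (hp : ∀ ω, 0 ≤ p ω) {E : Ω → Prop}
    {S : Finset ι} {f : ι → Ω} (hf : Set.InjOn f S) (hE : ∀ i ∈ S, E (f i)) :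
    ∑ i ∈ S, p (f i) ≤ prob p E := by
  rw [prob, ← Finset.sum_image hf]
  refine Finset.sum_le_sum_of_subset_of_nonneg (fun ω hω => ?_) fun ω _ _ => hp ω
  obtain ⟨i, hi, rfl⟩ := Finset.mem_image.1 hω
  simpa using hE i hi

lemma pairEnt_natCast_one (ℓ : ℕ) : pairEnt ℓ 1 =
    Real.logb 2 ((ℓ : ℝ) + 1) + ℓ * Real.logb 2 (((ℓ : ℝ) + 1) / ℓ) := by
  unfold pairEnt
  rw [one_div, Real.logb_inv, ← inv_div ((ℓ : ℝ) + 1) ℓ, Real.logb_inv]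
  ring

section Lower

variable {α β : ℝ} {n : ℕ}

lemma pairEnt_fiber_ge (hα : 0 < α) (hα' : α < 1) (hβ : 0 < β) (hβ' : β < 1)
    {j ℓ : ℕ} (x : Fin n → Bool) (h : ℓ + j + 1 ≤ n)
    (hfd : FirstDiff (ext x) (j + 1) ℓ) (g : _ → Bool × (Fin n → Bool) × List Bool × Bool)
    (hg : g = fun ω : (Fin n → Bool) × (Fin (n + 2) → Bool) =>
      (ω.2 0, ω.1, yOut ω, ω.2 (Fin.last (n + 1)))) :
    (1 / 2 : ℝ) ^ n * patWeight α β n j * pairEnt ℓ 1 ≤ pairEnt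
      (prob (pJoint α β n) fun ω => ω.2 1 = false ∧
        g ω = (false, x, (List.ofFn x).drop (j + 1), false))
      (prob (pJoint α β n) fun ω => ω.2 1 = true ∧
        g ω = (false, x, (List.ofFn x).drop (j + 1), false)) := by
  subst hg
  have hα1 : 0 < 1 - α := by linarith
  have hβ1 : 0 < 1 - β := by linarith
  have hw : 0 < (1 / 2 : ℝ) ^ n * patWeight α β n j := by
    unfold patWeight
    positivity
  have hpos : ∀ ω, 0 ≤ pJoint α β n ω := fun ω => (pJoint_pos hα hα' hβ hβ' ω).le
  have hz : ∀ s ≤ ℓ, ((pat n s j) 0, x, yOut (x, pat n s j), pat n s j (Fin.last (n + 1))) =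
      (false, x, (List.ofFn x).drop (j + 1), false) := fun s hs => by
    rw [yOut_pat x (by omega) fun k hk => hfd.1 k (by omega)]
    have h1 : pat n s j 0 = false := by simp [pat]
    have h2 : pat n s j (Fin.last (n + 1)) = false := by
      simp [pat]
      omega
    rw [h1, h2]
  have hone : ∀ s, pat n s j 1 = decide (s < 1 ∧ 1 ≤ s + j + 1) := fun s => rfl
  have hp : ∀ s ≤ ℓ, (1 / 2 : ℝ) ^ n * patWeight α β n j ≤ pJoint α β n (x, pat n s j) :=
    fun s hs => mul_le_mul_of_nonneg_left (patWeight_le hα hα' hβ hβ' (by omega)) (by positivity)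
  rw [← pairEnt_mul hw, mul_one]
  refine pairEnt_mono (by positivity) hw.le ?_ ?_
  · refine le_trans ?_ (sum_le_prob hpos (S := Finset.Ico 1 (ℓ + 1))
      (f := fun s => (x, pat n s j)) ?_ ?_)
    · refine le_trans ?_ (Finset.card_nsmul_le_sum _ _ ((1 / 2 : ℝ) ^ n * patWeight α β n j)
        fun s hs => hp s ?_)
      · rw [Nat.card_Ico, Nat.add_sub_cancel, nsmul_eq_mul, mul_comm]
      · rw [Finset.mem_Ico] at hs
        omega
    · intro s hs s' hs' heq
      simp only [Finset.coe_Ico, Set.mem_Ico] at hs hs'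
      exact pat_injective (by omega) (by omega) (Prod.ext_iff.1 heq).2
    · intro s hs
      rw [Finset.mem_Ico] at hs
      refine ⟨?_, hz s (by omega)⟩
      dsimp only
      rw [hone, decide_eq_false (by omega)]
  · refine (hp 0 (Nat.zero_le ℓ)).trans ?_
    have := sum_le_prob hpos (S := {0}) (f := fun s => (x, pat n s j))
      (E := fun ω => ω.2 1 = true ∧ (ω.2 0, ω.1, yOut ω, ω.2 (Fin.last (n + 1))) =
        (false, x, (List.ofFn x).drop (j + 1), false)) (by simp) (fun s hs => by
          rw [Finset.mem_singleton] at hs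
          subst hs
          refine ⟨?_, hz 0 (Nat.zero_le ℓ)⟩
          dsimp only
          rw [hone, decide_eq_true (by omega)])
    rwa [Finset.sum_singleton] at this

lemma le_Eseq (hα : 0 < α) (hα' : α < 1) (hβ : 0 < β) (hβ' : β < 1) {L r : ℕ} (hn : L + r ≤ n) :
    (∑ j ∈ Finset.range r, patWeight α β n j) * mainTerm L ≤ Eseq α β n := by
  unfold Eseq
  set g : (Fin n → Bool) × (Fin (n + 2) → Bool) → Bool × (Fin n → Bool) × List Bool × Bool :=
    fun ω => (ω.2 0, ω.1, yOut ω, ω.2 (Fin.last (n + 1))) with hg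
  rw [condEnt_bool]
  have hpos : ∀ E, 0 ≤ prob (pJoint α β n) E := fun E =>
    Finset.sum_nonneg fun ω _ => (pJoint_pos hα hα' hβ hβ' ω).le
  set T := fun z => pairEnt (prob (pJoint α β n) fun ω => ω.2 1 = false ∧ g ω = z)
    (prob (pJoint α β n) fun ω => ω.2 1 = true ∧ g ω = z) with hT
  let z : (Fin n → Bool) × ℕ → Bool × (Fin n → Bool) × List Bool × Bool :=
    fun q => (false, q.1, (List.ofFn q.1).drop (q.2 + 1), false)
  have hinj : Set.InjOn z (Finset.univ ×ˢ Finset.range r : Finset ((Fin n → Bool) × ℕ)) := by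
    rintro ⟨x, j⟩ hj ⟨x', j'⟩ hj' heq
    simp only [Finset.coe_product, Set.mem_prod, Finset.coe_range, Set.mem_Iio] at hj hj'
    simp only [z, Prod.mk.injEq, true_and, and_true] at heq
    have hlen := congrArg List.length heq.2
    simp only [List.length_drop, List.length_ofFn] at hlen
    exact Prod.ext heq.1 (by dsimp only; omega)
  have hsub : (Finset.univ ×ˢ Finset.range r).image z ⊆ Finset.univ.image g := by
    intro q hq
    obtain ⟨⟨x, j⟩, hj, rfl⟩ := Finset.mem_image.1 hq
    simp only [Finset.mem_product, Finset.mem_range] at hj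
    refine Finset.mem_image.2 ⟨(x, pat n 0 j), Finset.mem_univ _, ?_⟩
    have h1 : pat n 0 j 0 = false := by simp [pat]
    have h2 : pat n 0 j (Fin.last (n + 1)) = false := by
      simp [pat]
      omega
    simp only [hg, z]
    rw [yOut_pat x (by omega) fun k hk => absurd hk (by omega), h1, h2]
  have hterm : ∀ x : Fin n → Bool, ∀ j ∈ Finset.range r, ∑ ℓ ∈ Finset.range L,
      (if FirstDiff (ext x) (j + 1) ℓ then
        (1 / 2 : ℝ) ^ n * patWeight α β n j * pairEnt ℓ 1 else 0) ≤ T (z (x, j)) := by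
    intro x j hj
    rw [Finset.mem_range] at hj
    by_cases hex : ∃ ℓ < L, FirstDiff (ext x) (j + 1) ℓ
    · obtain ⟨ℓ, hℓ, hfd⟩ := hex
      rw [Finset.sum_eq_single ℓ, if_pos hfd]
      · exact pairEnt_fiber_ge hα hα' hβ hβ' x (by omega) hfd g hg
      · intro ℓ' _ hne
        refine if_neg fun hfd' => ?_
        rcases lt_or_gt_of_ne hne with h1 | h1
        · exact hfd'.2 (hfd.1 ℓ' h1)
        · exact hfd.2 (hfd'.1 ℓ h1)
      · intro h
        exact absurd (Finset.mem_range.2 hℓ) h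
    · rw [Finset.sum_eq_zero]
      · exact pairEnt_nonneg (hpos _) (hpos _)
      · intro ℓ hℓ
        exact if_neg fun h => hex ⟨ℓ, Finset.mem_range.1 hℓ, h⟩
  calc (∑ j ∈ Finset.range r, patWeight α β n j) * mainTerm L
      = ∑ x : Fin n → Bool, ∑ j ∈ Finset.range r, ∑ ℓ ∈ Finset.range L,
        (if FirstDiff (ext x) (j + 1) ℓ then
          (1 / 2 : ℝ) ^ n * patWeight α β n j * pairEnt ℓ 1 else 0) := by
        rw [Finset.sum_comm, Finset.sum_mul]
        refine Finset.sum_congr rfl fun j hj => ?_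
        rw [Finset.sum_comm, mainTerm, Finset.mul_sum]
        refine Finset.sum_congr rfl fun ℓ hℓ => ?_
        rw [Finset.mem_range] at hj hℓ
        rw [← pairEnt_natCast_one, ← uProb_firstDiff (n := n) (h := j + 1) (by omega) (by omega),
          uProb, Finset.mul_sum, Finset.sum_mul, Finset.mul_sum]
        refine Finset.sum_congr rfl fun x _ => ?_
        split_ifs <;> ring
    _ ≤ ∑ x : Fin n → Bool, ∑ j ∈ Finset.range r, T (z (x, j)) :=
        Finset.sum_le_sum fun x _ => Finset.sum_le_sum (hterm x)
    _ = ∑ q ∈ (Finset.univ ×ˢ Finset.range r).image z, T q := by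
        rw [Finset.sum_image hinj, Finset.sum_product]
    _ ≤ ∑ q ∈ Finset.univ.image g, T q :=
        Finset.sum_le_sum_of_subset_of_nonneg hsub fun q _ _ => pairEnt_nonneg (hpos _) (hpos _)

end Lower

/-! ### Asymptotics -/

section Asymptotics

variable {α β : ℝ}

lemma half_pow_ceil_le (hβ : 0 < β) : (1 / 2 : ℝ) ^ ⌈-Real.logb 2 β⌉₊ ≤ β := by
  have h1 : (2 : ℝ) ^ (-(⌈-Real.logb 2 β⌉₊ : ℝ)) ≤ 2 ^ Real.logb 2 β :=
    Real.rpow_le_rpow_of_exponent_le one_le_two (by linarith [Nat.le_ceil (-Real.logb 2 β)])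
  rwa [Real.rpow_logb (by norm_num) (by norm_num) hβ, Real.rpow_neg (by norm_num),
    Real.rpow_natCast, ← inv_pow, ← one_div] at h1

lemma half_pow_le (hβ : 0 < β) {k : ℕ} (hk : ⌈-Real.logb 2 β⌉₊ ≤ k) : (1 / 2 : ℝ) ^ k ≤ β :=
  (pow_le_pow_of_le_one (by norm_num) (by norm_num) hk).trans (half_pow_ceil_le hβ)

lemma one_le_neg_logb (hβ : 0 < β) (hβ4 : β < 1 / 4) : 1 ≤ -Real.logb 2 β := by
  have := Real.logb_le_logb_of_le one_lt_two hβ (by linarith : β ≤ 2⁻¹)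
  rw [Real.logb_inv, Real.logb_self_eq_one one_lt_two] at this
  linarith

lemma three_quarters_pow_le (hβ : 0 < β) : (3 / 4 : ℝ) ^ (3 * ⌈-Real.logb 2 β⌉₊) ≤ β := by
  rw [pow_mul]
  exact (pow_le_pow_left₀ (by norm_num) (by norm_num) _).trans (half_pow_ceil_le hβ)

lemma Eseq_sub_le (hα : 0 < α) (hα' : α < 1) (hβ : 0 < β) (hβ4 : β < 1 / 4) {c n N : ℕ}
    (hc : (1 - α) ^ c ≤ 1 / 2) (hN : N = ⌈-Real.logb 2 β⌉₊) (hn : 6 * N + c * N + c * N ≤ n) :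
    Eseq α β n - Cconst * β ≤ (22 + 3 * c + 6 * c * (1 / α) + 6 * ((6 + c) ^ 2 + (6 + c) +
      (6 + c) * (1 / α) + 1 / α)) * ((N : ℝ) ^ 3 * β ^ 2) := by
  have hlog := one_le_neg_logb hβ hβ4
  have hN1 : 1 ≤ N := by
    rw [hN]
    exact Nat.one_le_ceil_iff.2 (by linarith)
  have hν : (1 : ℝ) ≤ N := by exact_mod_cast hN1
  have hlogN : -Real.logb 2 β ≤ N := by
    rw [hN]
    exact Nat.le_ceil _
  have hβ2 : β ^ 2 ≤ 1 / 2 := by nlinarith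
  have hmain := Eseq_le hα hα' hβ (by linarith : β < 1) hβ2 (L := 3 * N) (r := c * N)
    (t := 6 * N) (n := n) (by omega) (by omega) hn
  have hB0 : 0 ≤ maxCost β (3 * N) := zero_le_one.trans (maxCost_ge_one hβ hβ2)
  have hB : maxCost β (3 * N) ≤ 6 * N := by
    unfold maxCost
    push_cast
    linarith
  have hp1 : (1 / 2 : ℝ) ^ (3 * N) ≤ β := half_pow_le hβ (by omega)
  have hp2 : (1 / 2 : ℝ) ^ (6 * N - 3 * N) ≤ β := half_pow_le hβ (by omega)
  have hp3 : (1 / 2 : ℝ) ^ (6 * N) ≤ β := half_pow_le hβ (by omega)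
  have hα1 : 0 ≤ 1 - α := by linarith
  have ha : (1 - α) ^ (c * N) ≤ β := by
    rw [pow_mul]
    exact (pow_le_pow_left₀ (pow_nonneg hα1 c) hc N).trans (half_pow_le hβ hN.ge)
  have hd : β / (α + β) ≤ 1 / α * β := by
    rw [one_div_mul_eq_div]
    exact div_le_div_of_nonneg_left hβ.le hα (by linarith)
  have hA : 0 < 1 / α := by positivity
  have hS : β * mainTerm (3 * N) ≤ Cconst * β + 12 * β ^ 2 := by
    have h1 := (abs_le.1 (abs_mainTerm_sub_le (3 * N))).2
    have h2 : (3 / 4 : ℝ) ^ (3 * N) ≤ β := hN ▸ three_quarters_pow_le hβ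
    nlinarith
  set Q := (N : ℝ) ^ 3 * β ^ 2 with hQ
  have q0 : β ^ 2 ≤ Q := le_mul_of_one_le_left (by positivity) (one_le_pow₀ hν)
  have q1 : (N : ℝ) * β ^ 2 ≤ Q :=
    mul_le_mul_of_nonneg_right (le_self_pow₀ hν (by norm_num)) (by positivity)
  have q2 : (N : ℝ) ^ 2 * β ^ 2 ≤ Q :=
    mul_le_mul_of_nonneg_right (pow_le_pow_right₀ hν (by norm_num)) (by positivity)
  have herr : 4 * β ^ 2 + β * ((1 / 2 : ℝ) ^ (3 * N) * maxCost β (3 * N)) +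
      ((3 * N : ℕ) : ℝ) * (β * (((c * N : ℕ) : ℝ) * (1 / 2 : ℝ) ^ (6 * N - 3 * N))) +
      ((c * N : ℕ) : ℝ) * (β / (α + β) * ((1 / 2 : ℝ) ^ (6 * N) * maxCost β (3 * N))) +
      (((6 * N + c * N : ℕ) : ℝ) ^ 2 * β ^ 2 +
        ((6 * N + c * N : ℕ) : ℝ) * (β * (1 - α) ^ (c * N)) +
        ((6 * N + c * N : ℕ) : ℝ) * (β * (β / (α + β))) +
        (1 - α) ^ (c * N) * (β / (α + β))) * maxCost β (3 * N) ≤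
      (10 + 3 * c + 6 * c * (1 / α) + 6 * ((6 + c) ^ 2 + (6 + c) +
      (6 + c) * (1 / α) + 1 / α)) * Q := by
    calc _ ≤ 4 * β ^ 2 + β * (β * (6 * N)) +
          ((3 * N : ℕ) : ℝ) * (β * (((c * N : ℕ) : ℝ) * β)) +
          ((c * N : ℕ) : ℝ) * ((1 / α * β) * (β * (6 * N))) +
          (((6 * N + c * N : ℕ) : ℝ) ^ 2 * β ^ 2 + ((6 * N + c * N : ℕ) : ℝ) * (β * β) +
            ((6 * N + c * N : ℕ) : ℝ) * (β * (1 / α * β)) + β * (1 / α * β)) * (6 * N) := by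
          gcongr
      _ = 4 * β ^ 2 + (6 + 6 * (1 / α)) * (N * β ^ 2) +
          (3 * c + 6 * c * (1 / α) + 6 * (6 + c) + 6 * (6 + c) * (1 / α)) * (N ^ 2 * β ^ 2) +
          6 * (6 + c) ^ 2 * Q := by
          rw [hQ]
          push_cast
          ring
      _ ≤ 4 * Q + (6 + 6 * (1 / α)) * Q +
          (3 * c + 6 * c * (1 / α) + 6 * (6 + c) + 6 * (6 + c) * (1 / α)) * Q +
          6 * (6 + c) ^ 2 * Q := by gcongr
      _ = _ := by ring
  linarith

lemma le_Eseq_sub (hα : 0 < α) (hα' : α < 1) (hβ : 0 < β) (hβ4 : β < 1 / 4) {c n N : ℕ}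
    (hc : (1 - α) ^ c ≤ 1 / 2) (hN : N = ⌈-Real.logb 2 β⌉₊) (hn : n = 3 * N + c * N) :
    -((12 + (|Cconst| + 12) * (1 / α + (3 + c) + 2)) * ((N : ℝ) ^ 3 * β ^ 2)) ≤
      Eseq α β n - Cconst * β := by
  have hlog := one_le_neg_logb hβ hβ4
  have hN1 : 1 ≤ N := by
    rw [hN]
    exact Nat.one_le_ceil_iff.2 (by linarith)
  have hν : (1 : ℝ) ≤ N := by exact_mod_cast hN1
  have hα1 : 0 ≤ 1 - α := by linarith
  have hA : 0 < 1 / α := by positivity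
  have hmain := le_Eseq hα hα' hβ (by linarith : β < 1) (L := 3 * N) (r := c * N) (n := n) hn.ge
  have ha : (1 - α) ^ (c * N) ≤ β := by
    rw [pow_mul]
    exact (pow_le_pow_left₀ (pow_nonneg hα1 c) hc N).trans (half_pow_le hβ hN.ge)
  have hS := abs_le.1 (abs_mainTerm_sub_le (3 * N))
  have hq : (3 / 4 : ℝ) ^ (3 * N) ≤ β := hN ▸ three_quarters_pow_le hβ
  have hSM : mainTerm (3 * N) ≤ |Cconst| + 12 := by
    linarith [le_abs_self Cconst, hS.2]
  have hS0 : 0 ≤ mainTerm (3 * N) := Finset.sum_nonneg fun ℓ _ => mul_nonneg (by positivity)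
    (add_nonneg (logb_add_one_nonneg ℓ) (mul_nonneg (Nat.cast_nonneg ℓ) (logb_ratio_nonneg ℓ)))
  have hsum : ∑ j ∈ Finset.range (c * N), patWeight α β n j =
      β * (α / (α + β) * (1 - β) ^ (n + 1) * (1 - (1 - α) ^ (c * N))) := by
    have hgeom : ∑ j ∈ Finset.range (c * N), α * (1 - α) ^ j = 1 - (1 - α) ^ (c * N) := by
      have := mul_neg_geom_sum (1 - α) (c * N)
      rw [← Finset.mul_sum]
      linarith
    rw [← hgeom, Finset.mul_sum, Finset.mul_sum]
    exact Finset.sum_congr rfl fun j _ => by unfold patWeight; ring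
  have f1 : 1 - 1 / α * β ≤ α / (α + β) := by
    rw [le_div_iff₀ (by positivity)]
    have : (1 - 1 / α * β) * (α + β) = α - 1 / α * β ^ 2 := by
      field_simp
      ring
    rw [this]
    linarith [show 0 ≤ 1 / α * β ^ 2 by positivity]
  have f1' : α / (α + β) ≤ 1 := div_le_one_of_le₀ (by linarith) (by positivity)
  have f2 : 1 - (n + 1) * β ≤ (1 - β) ^ (n + 1) := by
    have := one_add_mul_le_pow (a := -β) (by linarith) (n + 1)
    push_cast at this
    rw [← sub_eq_add_neg] at this
    linarith
  have f2' : (1 - β) ^ (n + 1) ≤ 1 := pow_le_one₀ (by linarith) (by linarith)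
  have f2'' : 0 ≤ (1 - β) ^ (n + 1) := pow_nonneg (by linarith) _
  set F := α / (α + β) * (1 - β) ^ (n + 1) * (1 - (1 - α) ^ (c * N)) with hF
  have hFle : 1 - F ≤ 1 / α * β + (n + 1) * β + β := by
    have g1 : α / (α + β) + (1 - β) ^ (n + 1) - 1 ≤ α / (α + β) * (1 - β) ^ (n + 1) := by
      nlinarith
    have g2 : α / (α + β) * (1 - β) ^ (n + 1) ≤ 1 := mul_le_one₀ f1' f2'' f2'
    have g3 : 0 ≤ α / (α + β) * (1 - β) ^ (n + 1) := by positivity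
    have g4 : 0 ≤ (1 - α) ^ (c * N) := pow_nonneg hα1 _
    have g5 : α / (α + β) * (1 - β) ^ (n + 1) - β ≤ F := by
      rw [hF]
      nlinarith
    linarith
  have hn' : (n : ℝ) = (3 + c) * N := by
    rw [hn]
    push_cast
    ring
  set Q := (N : ℝ) ^ 3 * β ^ 2 with hQ
  have q0 : β ^ 2 ≤ Q := le_mul_of_one_le_left (by positivity) (one_le_pow₀ hν)
  have q1 : (N : ℝ) * β ^ 2 ≤ Q :=
    mul_le_mul_of_nonneg_right (le_self_pow₀ hν (by norm_num)) (by positivity)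
  have hFM : (1 - F) * mainTerm (3 * N) ≤
      (|Cconst| + 12) * (1 / α * β + (n + 1) * β + β) := by
    have hrhs : 0 ≤ 1 / α * β + ((n : ℝ) + 1) * β + β := by positivity
    rw [mul_comm]
    exact (mul_le_mul_of_nonneg_left hFle hS0).trans (mul_le_mul_of_nonneg_right hSM hrhs)
  have h1 : β * ((1 - F) * mainTerm (3 * N)) ≤
      (|Cconst| + 12) * (1 / α + (3 + c) + 2) * Q := by
    calc _ ≤ β * ((|Cconst| + 12) * (1 / α * β + (n + 1) * β + β)) := by gcongr
      _ = (|Cconst| + 12) * (1 / α * β ^ 2 + (3 + c) * (N * β ^ 2) + 2 * β ^ 2) := by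
          rw [hn']
          ring
      _ ≤ (|Cconst| + 12) * (1 / α * Q + (3 + c) * Q + 2 * Q) := by gcongr
      _ = _ := by ring
  have h2 : β * (Cconst - 12 * β) ≤ β * mainTerm (3 * N) :=
    mul_le_mul_of_nonneg_left (by linarith [hS.1]) hβ.le
  have h3 : (β * F) * mainTerm (3 * N) = β * mainTerm (3 * N) -
      β * ((1 - F) * mainTerm (3 * N)) := by ring
  rw [hsum, h3] at hmain
  have h4 : β * (Cconst - 12 * β) = Cconst * β - 12 * β ^ 2 := by ring
  linarith

lemma ceil_pow_three_mul_le {ε : ℝ} (hε : 0 < ε) (hβ : 0 < β) (hβ4 : β < 1 / 4) :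
    (⌈-Real.logb 2 β⌉₊ : ℝ) ^ 3 * β ^ 2 ≤ (4 / (ε / 3)) ^ 3 * β ^ (2 - ε) := by
  have hlog := one_le_neg_logb hβ hβ4
  have h1 : (⌈-Real.logb 2 β⌉₊ : ℝ) ≤ 2 * (-Real.logb 2 β) := by
    linarith [Nat.ceil_lt_add_one (by linarith : 0 ≤ -Real.logb 2 β)]
  have h2 : -Real.logb 2 β ≤ 2 * (β⁻¹ ^ (ε / 3) / (ε / 3)) := by
    have h3 := Real.log_le_rpow_div (inv_nonneg.2 hβ.le) (by positivity : 0 < ε / 3)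
    have h4 : 1 / 2 < Real.log 2 := by linarith [Real.log_two_gt_d9]
    have h5 : 0 ≤ β⁻¹ ^ (ε / 3) / (ε / 3) := by positivity
    rw [← Real.logb_inv, Real.logb, div_le_iff₀ (by linarith)]
    nlinarith
  have h3 : (⌈-Real.logb 2 β⌉₊ : ℝ) ≤ 4 / (ε / 3) * β⁻¹ ^ (ε / 3) := by
    calc _ ≤ 2 * (2 * (β⁻¹ ^ (ε / 3) / (ε / 3))) := by linarith
      _ = _ := by ring
  have h4 : (β⁻¹ ^ (ε / 3)) ^ 3 * β ^ 2 = β ^ (2 - ε) := by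
    rw [← Real.rpow_natCast, ← Real.rpow_mul (inv_nonneg.2 hβ.le), Real.inv_rpow hβ.le,
      ← Real.rpow_neg hβ.le, ← Real.rpow_natCast β 2, ← Real.rpow_add hβ]
    congr 1
    push_cast
    ring
  calc _ ≤ (4 / (ε / 3) * β⁻¹ ^ (ε / 3)) ^ 3 * β ^ 2 := by gcongr
    _ = _ := by rw [mul_pow, mul_assoc, h4]

end Asymptotics

/-- Fix `α ∈ (0,1)`. For every `ε > 0` there are `K > 0`, `β₀ > 0` such
that for all `β ∈ (0, β₀)`: `|E_∞(α,β) − C β| ≤ K β^{2−ε}`, where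
`E_∞(α,β) = lim_n H(D_1 | D_0, X^n, y(X^n,D^n), D_{n+1})`. -/
theorem natures_secret_asymptotic (α : ℝ) (hα : 0 < α ∧ α < 1) (ε : ℝ) (hε : 0 < ε) :
    ∃ Einf : ℝ → ℝ,
      (∀ β : ℝ, 0 < β → β < 1 →
        Tendsto (fun n : ℕ => Eseq α β n) atTop (nhds (Einf β))) ∧
      ∃ K : ℝ, 0 < K ∧ ∃ β₀ : ℝ, 0 < β₀ ∧ ∀ β : ℝ, 0 < β → β < β₀ →
        |Einf β - Cconst * β| ≤ K * β ^ ((2 : ℝ) - ε) := by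
  obtain ⟨hα, hα'⟩ := hα
  have hex : ∀ β : ℝ, ∃ E : ℝ, 0 < β → β < 1 →
      Tendsto (fun n => Eseq α β n) atTop (nhds E) ∧ ∀ n, Eseq α β n ≤ E := fun β => by
    by_cases h : 0 < β ∧ β < 1
    · obtain ⟨E, hE⟩ := exists_tendsto_Eseq hα hα' h.1 h.2
      exact ⟨E, fun _ _ => hE⟩
    · exact ⟨0, fun h1 h2 => absurd ⟨h1, h2⟩ h⟩
  choose Einf hEinf using hex
  refine ⟨Einf, fun β h1 h2 => (hEinf β h1 h2).1, ?_⟩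
  obtain ⟨c, hc⟩ := exists_pow_lt_of_lt_one (by norm_num : (0 : ℝ) < 1 / 2)
    (by linarith : 1 - α < 1)
  have hA : 0 < 1 / α := by positivity
  set K₁ : ℝ := 22 + 3 * c + 6 * c * (1 / α) + 6 * ((6 + c) ^ 2 + (6 + c) +
    (6 + c) * (1 / α) + 1 / α) with hK₁
  set K₂ : ℝ := 12 + (|Cconst| + 12) * (1 / α + (3 + c) + 2) with hK₂
  have hK₁pos : 0 < K₁ := by positivity
  have hK₂pos : 0 < K₂ := by positivity
  refine ⟨(K₁ + K₂) * (4 / (ε / 3)) ^ 3, by positivity, 1 / 4, by norm_num, fun β hβ hβ4 => ?_⟩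
  obtain ⟨hlim, hle⟩ := hEinf β hβ (by linarith)
  have hQ := ceil_pow_three_mul_le hε hβ hβ4
  have hQ0 : 0 ≤ (⌈-Real.logb 2 β⌉₊ : ℝ) ^ 3 * β ^ 2 := by positivity
  have hup : Einf β ≤ Cconst * β + K₁ * ((⌈-Real.logb 2 β⌉₊ : ℝ) ^ 3 * β ^ 2) := by
    refine le_of_tendsto hlim ((eventually_ge_atTop
      (6 * ⌈-Real.logb 2 β⌉₊ + c * ⌈-Real.logb 2 β⌉₊ + c * ⌈-Real.logb 2 β⌉₊)).mono fun n hn => ?_)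
    linarith [Eseq_sub_le hα hα' hβ hβ4 hc.le rfl hn]
  have hlow := le_Eseq_sub hα hα' hβ hβ4 hc.le rfl rfl
  have hle' := hle (3 * ⌈-Real.logb 2 β⌉₊ + c * ⌈-Real.logb 2 β⌉₊)
  have hK := mul_le_mul_of_nonneg_left hQ (by positivity : 0 ≤ K₁ + K₂)
  rw [← mul_assoc] at hK
  have h1 := mul_nonneg hK₁pos.le hQ0
  have h2 := mul_nonneg hK₂pos.le hQ0
  rw [abs_le]
  constructor <;> linarith

end SyncDeletion
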